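/- arXiv:2301.00708 — 3 statements merged into one kernel-verified Lean document; each statement's English description precedes it below -/
import Mathlib

section
/- Let R be a ring and S a class of strongly finitely presented right R-modules containing the free module R and closed under direct summands, extensions, and kernels of epimorphisms. Put B = S^{⊥₁}, C = lim→ S, and D = C^{⊥₁}. Then in any acyclic complex of right R-modules whose terms belong to D and whose modules of cocycles belong to B, the modules of cocycles actually belong to D. -/
open CategoryTheory CategoryTheory.Limits

universe w v u

namespace GenPeriodicity

variable {K : Type u} [Category.{v} K]

section AbelianDefs

variable [Abelian K]

/-- `Ext¹(X, Y) = 0`, expressed by the splitting of all short exact sequences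
`0 → Y → E → X → 0`. -/
def Ext1Zero (X Y : K) : Prop :=
  ∀ (E : K) (i : Y ⟶ E) (p : E ⟶ X) (w : i ≫ p = 0),
    (ShortComplex.mk i p w).ShortExact → ∃ s : X ⟶ E, s ≫ p = 𝟙 X

/-- The right `Ext¹`-orthogonal class `S^{⊥₁}`. -/
def rightPerp (S : Set K) : Set K := {B | ∀ X ∈ S, Ext1Zero X B}

/-- The left `Ext¹`-orthogonal class `^{⊥₁}B`. -/
def leftPerp (B : Set K) : Set K := {A | ∀ Y ∈ B, Ext1Zero A Y}

/-- A class of objects is closed under extensions. -/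
def ClosedUnderExtensions (C : Set K) : Prop :=
  ∀ (X : ShortComplex K), X.ShortExact → X.X₁ ∈ C → X.X₃ ∈ C → X.X₂ ∈ C

/-- A class of objects is closed under kernels of epimorphisms. -/
def ClosedUnderKernelsOfEpis (C : Set K) : Prop :=
  ∀ (X : ShortComplex K), X.ShortExact → X.X₂ ∈ C → X.X₃ ∈ C → X.X₁ ∈ C

/-- A class of objects is closed under direct summands (retracts). -/
def ClosedUnderDirectSummands (C : Set K) : Prop :=
  ∀ X ∈ C, ∀ (Y : K) (s : Y ⟶ X) (r : X ⟶ Y), s ≫ r = 𝟙 Y → Y ∈ C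

/-- A (doubly unbounded) complex is acyclic if it is exact at every term. -/
def IsAcyclic (X : CochainComplex K ℤ) : Prop := ∀ n : ℤ, X.ExactAt n

end AbelianDefs

/-- Data exhibiting `M` as a direct limit (over a directed poset) of objects from `S`. -/
structure DirectSystemTo (S : Set K) (M : K) where
  I : Type v
  [po : PartialOrder I]
  dir : IsDirected I (· ≤ ·)
  ne : Nonempty I
  F : I ⥤ K
  mem : ∀ i, F.obj i ∈ S
  c : Cocone F
  hc : IsColimit c
  iso : c.pt ≅ M

/-- `lim→ S`: the class of all direct limits of direct systems of objects of `S`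
indexed by directed posets. -/
def limClosure (S : Set K) : Set K := {M | Nonempty (DirectSystemTo S M)}

/-- A class of objects is closed under direct limits (indexed by directed posets). -/
def ClosedUnderDirectLimits (C : Set K) : Prop :=
  ∀ (I : Type v) [PartialOrder I], IsDirected I (· ≤ ·) → Nonempty I →
    ∀ (F : I ⥤ K), (∀ i, F.obj i ∈ C) → ∀ (c : Cocone F), IsColimit c → c.pt ∈ C

/-- A class of objects is closed under (set-indexed) coproducts. -/
def ClosedUnderCoproducts (C : Set K) : Prop :=
  ∀ (B : Type v) (X : B → K), (∀ b, X b ∈ C) → ∀ (c : Cofan X), IsColimit c → c.pt ∈ C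

/-- A right `R`-module (as a left `Rᵐᵒᵖ`-module) is strongly finitely presented
(of type `FP_∞`) if it admits a resolution by finitely generated projective modules. -/
def StronglyFinitelyPresented {R : Type u} [Ring R] (M : ModuleCat.{u} Rᵐᵒᵖ) : Prop :=
  ∃ (P : ℕ → ModuleCat.{u} Rᵐᵒᵖ) (d : ∀ n, P (n + 1) ⟶ P n) (ε : P 0 ⟶ M)
    (w0 : d 0 ≫ ε = 0) (w : ∀ n, d (n + 1) ≫ d n = 0),
    (∀ n, Projective (P n)) ∧ (∀ n, Module.Finite Rᵐᵒᵖ (P n)) ∧ Epi ε ∧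
    (ShortComplex.mk (d 0) ε w0).Exact ∧
    (∀ n, (ShortComplex.mk (d (n + 1)) (d n) (w n)).Exact)

section Linear

variable {A : Type*} [Ring A]

/-- Every homomorphism from `M` to the codomain of `q` lifts along `q`. -/
def LiftsAlong (M : Type*) [AddCommGroup M] [Module A M] {J W : Type*} [AddCommGroup J]
    [Module A J] [AddCommGroup W] [Module A W] (q : J →ₗ[A] W) : Prop :=
  ∀ φ : M →ₗ[A] W, ∃ ψ : M →ₗ[A] J, q ∘ₗ ψ = φ

/-- A family of homomorphisms out of a direct system is a cocone over the indices in `T`. -/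
def IsCoconeOn {I : Type*} [Preorder I] {G : I → Type*} [∀ i, AddCommGroup (G i)]
    [∀ i, Module A (G i)] (f : ∀ i j, i ≤ j → G i →ₗ[A] G j) (T : Set I) {W : Type*}
    [AddCommGroup W] [Module A W] (φ : ∀ i, G i →ₗ[A] W) : Prop :=
  ∀ i ∈ T, ∀ j ∈ T, ∀ (h : i ≤ j) (x : G i), φ j (f i j h x) = φ i x

/-- Every cocone over the indices in `T` with vertex the codomain of `q` lifts along `q`. -/
def LiftsOn {I : Type*} [Preorder I] {G : I → Type*} [∀ i, AddCommGroup (G i)]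
    [∀ i, Module A (G i)] (f : ∀ i j, i ≤ j → G i →ₗ[A] G j) (T : Set I) {J W : Type*}
    [AddCommGroup J] [Module A J] [AddCommGroup W] [Module A W] (q : J →ₗ[A] W) : Prop :=
  ∀ φ : ∀ i, G i →ₗ[A] W, IsCoconeOn f T φ →
    ∃ ψ : ∀ i, G i →ₗ[A] J, IsCoconeOn f T ψ ∧ ∀ i ∈ T, ∀ x, q (ψ i x) = φ i x

section Chain

open DirectSum

variable {L : Type*} [LinearOrder L] {C : L → Type*} [∀ i, AddCommGroup (C i)]
  [∀ i, Module A (C i)] (f : ∀ i j, i ≤ j → C i →ₗ[A] C j)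

/-- The submodule of the direct sum spanned by the relations of the direct limit that involve
only indices in `U`. -/
def relations (U : Set L) : Submodule A (⨁ i, C i) :=
  Submodule.span A {y | ∃ (i j : L) (h : i ≤ j) (x : C i), j ∈ U ∧
    y = lof A L C i x - lof A L C j (f i j h x)}

lemma relation_mem {U : Set L} {i j : L} (h : i ≤ j) (hj : j ∈ U) (x : C i) :
    lof A L C i x - lof A L C j (f i j h x) ∈ relations f U :=
  Submodule.subset_span ⟨i, j, h, x, hj, rfl⟩

lemma relations_le {U : Set L} {N : Submodule A (⨁ i, C i)}
    (h : ∀ i j (h : i ≤ j), j ∈ U → ∀ x, lof A L C i x - lof A L C j (f i j h x) ∈ N) :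
    relations f U ≤ N := by
  refine Submodule.span_le.2 ?_
  rintro _ ⟨i, j, hij, x, hj, rfl⟩
  exact h i j hij hj x

lemma relations_mono {U V : Set L} (h : U ⊆ V) : relations f U ≤ relations f V :=
  relations_le f fun _ _ hij hj x ↦ relation_mem f hij (h hj) x

lemma relations_sUnion (c : Set (Set L)) :
    relations f (⋃₀ c) = sSup (relations f '' c) := by
  apply le_antisymm
  · refine relations_le f ?_
    rintro i j hij ⟨U, hU, hj⟩ x
    exact (le_sSup (Set.mem_image_of_mem _ hU) : relations f U ≤ _) (relation_mem f hij hj x)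
  · refine sSup_le ?_
    rintro _ ⟨U, hU, rfl⟩
    exact relations_mono f (Set.subset_sUnion_of_mem hU)

variable {J W J' W' : Type*} [AddCommGroup J] [Module A J] [AddCommGroup W] [Module A W]
  [AddCommGroup J'] [Module A J'] [AddCommGroup W'] [Module A W']

variable [WellFoundedLT L]

/-- A form of Eklof's lemma for the module of relations of a well-ordered direct system. -/
lemma exists_lift_relations (f_self : ∀ i x, f i i le_rfl x = x)
    (f_comp : ∀ i j k (hij : i ≤ j) (hjk : j ≤ k) x,
      f j k hjk (f i j hij x) = f i k (hij.trans hjk) x)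
    {q : J →ₗ[A] W} (hJ : Module.Baer A J) (h : ∀ γ : L, LiftsOn f (Set.Iio γ) q)
    {j : W →ₗ[A] J'} (hj : Function.Injective j) (Ψ : (⨁ i, C i) →ₗ[A] J')
    (hΨ : ∀ y ∈ relations f Set.univ, Ψ y ∈ LinearMap.range j) :
    ∃ Λ : (⨁ i, C i) →ₗ[A] J, ∀ y ∈ relations f Set.univ, j (q (Λ y)) = Ψ y := by
  classical
  let P : Set ((⨁ i, C i) →ₗ.[A] J) :=
    {p | (∃ U, IsLowerSet U ∧ p.domain = relations f U) ∧ ∀ y : p.domain, j (q (p y)) = Ψ y}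
  have bot_mem : (⊥ : (⨁ i, C i) →ₗ.[A] J) ∈ P := by
    refine ⟨⟨∅, isLowerSet_empty, ?_⟩, ?_⟩
    · exact le_antisymm bot_le (relations_le f (by simp))
    · rintro ⟨y, hy⟩
      obtain rfl : y = 0 := (Submodule.mem_bot A).1 hy
      have : (⟨0, hy⟩ : (⊥ : (⨁ i, C i) →ₗ.[A] J).domain) = 0 := rfl
      simp [this]
  obtain ⟨p, -, hp⟩ := zorn_le_nonempty₀ P (by
    intro c hcP hc y hy
    have hd := hc.directedOn
    refine ⟨LinearPMap.sSup c hd, ⟨?_, ?_⟩, fun z hz ↦ LinearPMap.le_sSup hd hz⟩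
    · refine ⟨⋃₀ {U | IsLowerSet U ∧ ∃ p ∈ c, p.domain = relations f U},
        isLowerSet_sUnion fun U hU ↦ hU.1, ?_⟩
      rw [LinearPMap.domain_sSup, relations_sUnion]
      congr 1
      ext N
      constructor
      · rintro ⟨p, hp, rfl⟩
        obtain ⟨⟨U, hU, hpU⟩, -⟩ := hcP hp
        exact ⟨U, ⟨hU, p, hp, hpU⟩, hpU.symm⟩
      · rintro ⟨U, ⟨-, p, hp, hpU⟩, rfl⟩
        exact ⟨p, hp, hpU⟩
    · rintro ⟨z, hz⟩
      obtain ⟨p, hp, hzp⟩ := (LinearPMap.mem_domain_sSup_iff ⟨y, hy⟩ hd).1 hz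
      rw [← (hcP hp).2 ⟨z, hzp⟩, ← LinearPMap.sSup_apply hd hp ⟨z, hzp⟩]) ⊥ bot_mem
  obtain ⟨⟨⟨U₀, hU₀, hpU₀⟩, hpq⟩, hmax⟩ := hp
  let U : Set L := ⋃₀ {V | IsLowerSet V ∧ relations f V ≤ p.domain}
  have hU : IsLowerSet U := isLowerSet_sUnion fun V hV ↦ hV.1
  have hUle : relations f U ≤ p.domain := by
    rw [relations_sUnion]
    refine sSup_le ?_
    rintro _ ⟨V, hV, rfl⟩
    exact hV.2
  obtain ⟨g, hg⟩ := hJ.extension_property p.domain.subtype p.domain.injective_subtype p.toFun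
  replace hg : ∀ y (hy : y ∈ p.domain), g y = p ⟨y, hy⟩ := fun y hy ↦
    LinearMap.congr_fun hg ⟨y, hy⟩
  have hgq : ∀ y ∈ p.domain, j (q (g y)) = Ψ y := fun y hy ↦ by
    rw [hg y hy, hpq]
  by_cases hne : U = Set.univ
  · exact ⟨g, fun y hy ↦ hgq y (hUle (hne ▸ hy))⟩
  exfalso
  obtain ⟨γ, hγ, hγmin⟩ := WellFounded.has_min (wellFounded_lt (α := L)) Uᶜ
    (Set.nonempty_compl.2 hne)
  have hIio : Set.Iio γ ⊆ U := fun α hα ↦ by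
    by_contra hαU
    exact hγmin α hαU hα
  have hnot : ¬ relations f (Set.Iic γ) ≤ p.domain := fun hle ↦
    hγ (Set.mem_sUnion_of_mem (Set.mem_Iic.2 le_rfl) ⟨isLowerSet_Iic γ, hle⟩)
  have hUIio : U₀ ⊆ Set.Iio γ := fun α hα ↦ by
    by_contra hlt
    exact hγ (Set.mem_sUnion_of_mem (hU₀ (not_lt.1 hlt) hα) ⟨hU₀, hpU₀.ge⟩)
  have hdom : ∀ α β (hαβ : α ≤ β), β < γ → ∀ x : C α,
      lof A L C α x - lof A L C β (f α β hαβ x) ∈ p.domain := fun α β hαβ hβ x ↦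
    hUle (relation_mem f hαβ (hIio hβ) x)
  let jinv := (LinearEquiv.ofInjective j hj).symm
  have hjinv : ∀ z, j (jinv z) = z := fun z ↦ by
    rw [← LinearEquiv.ofInjective_apply j (h := hj), LinearEquiv.apply_symm_apply]
  let Δ : (⨁ i, C i) →ₗ[A] J' := Ψ - j ∘ₗ q ∘ₗ g
  have hΔ : ∀ y ∈ relations f Set.univ, Δ y ∈ LinearMap.range j := fun y hy ↦
    Submodule.sub_mem _ (hΨ y hy) ⟨_, rfl⟩
  have hΔ0 : ∀ y ∈ p.domain, Δ y = 0 := fun y hy ↦ by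
    simp [Δ, hgq y hy]
  let e : ∀ α, α < γ → C α →ₗ[A] (⨁ i, C i) := fun α hα ↦
    lof A L C α - lof A L C γ ∘ₗ f α γ hα.le
  have he : ∀ α hα x, Δ (e α hα x) ∈ LinearMap.range j := fun α hα x ↦
    hΔ _ (relation_mem f hα.le (Set.mem_univ _) x)
  let κ : ∀ α, C α →ₗ[A] W := fun α ↦ if hα : α < γ then
    jinv.toLinearMap ∘ₗ LinearMap.codRestrict _ (Δ ∘ₗ e α hα) (he α hα) else 0
  have hκ : ∀ α (hα : α < γ) x, j (κ α x) = Δ (e α hα x) := fun α hα x ↦ by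
    simp [κ, hα, hjinv]
  obtain ⟨η, hη, hηq⟩ := h γ κ (by
    intro α hα β hβ hαβ x
    apply hj
    rw [hκ α hα, hκ β hβ, ← sub_eq_zero, ← map_sub]
    rw [← neg_eq_zero, ← map_neg]
    convert hΔ0 _ (hdom α β hαβ hβ x) using 2
    simp [e, f_comp])
  let hh : (⨁ i, C i) →ₗ[A] J := toModule A L J fun α ↦ if α < γ then η α else 0
  have hh_lt : ∀ α, α < γ → ∀ x, hh (lof A L C α x) = η α x := fun α hα x ↦ by
    simp [hh, toModule_lof, hα]
  have hh_γ : ∀ x, hh (lof A L C γ x) = 0 := fun x ↦ by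
    simp [hh, toModule_lof]
  have hker : relations f (Set.Iio γ) ≤ LinearMap.ker hh :=
    relations_le f fun α β hαβ hβ x ↦ by
      have hα := hαβ.trans_lt hβ
      rw [LinearMap.mem_ker, map_sub, hh_lt α hα, hh_lt β hβ, hη α hα β hβ, sub_self]
  let p' : (⨁ i, C i) →ₗ.[A] J := ⟨relations f (Set.Iic γ), (g + hh).domRestrict _⟩
  have hp' : p' ∈ P := by
    refine ⟨⟨_, isLowerSet_Iic γ, rfl⟩, ?_⟩
    suffices relations f (Set.Iic γ) ≤ LinearMap.ker (Ψ - j ∘ₗ q ∘ₗ (g + hh)) by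
      rintro ⟨y, hy⟩
      have := this hy
      rw [LinearMap.mem_ker, LinearMap.sub_apply, sub_eq_zero] at this
      exact this.symm
    refine relations_le f fun α β hαβ hβ x ↦ ?_
    have key : ∀ y, j (q (hh y)) = Δ y → y ∈ LinearMap.ker (Ψ - j ∘ₗ q ∘ₗ (g + hh)) := by
      intro y hy
      rw [LinearMap.mem_ker]
      simp only [LinearMap.sub_apply, LinearMap.comp_apply, LinearMap.add_apply, map_add, hy, Δ]
      abel
    apply key
    rcases (Set.mem_Iic.1 hβ).lt_or_eq with hβ | rfl
    · rw [hΔ0 _ (hdom α β hαβ hβ x), LinearMap.mem_ker.1 (hker (relation_mem f hαβ hβ x))]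
      simp
    · rcases hαβ.lt_or_eq with hα | rfl
      · rw [map_sub hh, hh_lt α hα, hh_γ, sub_zero, hηq α hα, hκ α hα]
        rfl
      · simp [f_self]
  have hle : p ≤ p' := by
    refine ⟨hpU₀.le.trans (relations_mono f (hUIio.trans Set.Iio_subset_Iic_self)), ?_⟩
    rintro ⟨y, hy⟩ ⟨z, hz⟩ (rfl : y = z)
    have : hh y = 0 := hker (relations_mono f hUIio (hpU₀ ▸ hy))
    change p ⟨y, hy⟩ = g y + hh y
    rw [this, add_zero, hg y hy]
  exact hnot (hmax hp' hle).1

lemma liftsOn_chain (f_self : ∀ i x, f i i le_rfl x = x)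
    (f_comp : ∀ i j k (hij : i ≤ j) (hjk : j ≤ k) x,
      f j k hjk (f i j hij x) = f i k (hij.trans hjk) x)
    {q : J →ₗ[A] W} (hJ : Module.Baer A J) {j : W →ₗ[A] J'} {q' : J' →ₗ[A] W'}
    (hj : Function.Injective j) (hjq : Function.Exact j q')
    (h : ∀ γ : L, LiftsOn f (Set.Iio γ) q) (h' : ∀ i, LiftsAlong (C i) q') :
    LiftsOn f Set.univ q' := by
  intro φ hφ
  choose ψ hψ using fun i ↦ h' i (φ i)
  replace hψ : ∀ i x, q' (ψ i x) = φ i x := fun i x ↦ LinearMap.congr_fun (hψ i) x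
  let Ψ : (⨁ i, C i) →ₗ[A] J' := toModule A L J' ψ
  have hΨ : ∀ i x, Ψ (lof A L C i x) = ψ i x := fun i x ↦ toModule_lof A i x
  have hrel : relations f Set.univ ≤ LinearMap.ker (q' ∘ₗ Ψ) :=
    relations_le f fun i k hik _ x ↦ by
      rw [LinearMap.mem_ker, LinearMap.comp_apply, map_sub, map_sub, hΨ, hΨ, hψ, hψ,
        hφ i trivial k trivial, sub_self]
  obtain ⟨Λ, hΛ⟩ := exists_lift_relations f f_self f_comp hJ h hj Ψ
    fun y hy ↦ (hjq _).1 (hrel hy)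
  refine ⟨fun i ↦ ψ i - j ∘ₗ q ∘ₗ Λ ∘ₗ lof A L C i, ?_, ?_⟩
  · intro i _ k _ hik x
    have := hΛ _ (relation_mem f hik (Set.mem_univ k) x)
    simp only [map_sub, hΨ] at this
    simp only [LinearMap.sub_apply, LinearMap.comp_apply]
    rw [sub_eq_sub_iff_sub_eq_sub, ← neg_inj, neg_sub, neg_sub, ← this]
  · intro i _ x
    simp [hψ, hjq.apply_apply_eq_zero]

end Chain
section Lifting

lemma exists_factor_of_surjective {F C W : Type*} [AddCommGroup F] [Module A F] [AddCommGroup C]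
    [Module A C] [AddCommGroup W] [Module A W] {b : F →ₗ[A] C} (hb : Function.Surjective b)
    (φ : F →ₗ[A] W) (h : ∀ x, b x = 0 → φ x = 0) : ∃ φ' : C →ₗ[A] W, ∀ x, φ' (b x) = φ x := by
  refine ⟨(LinearMap.ker b).liftQ φ (fun x hx ↦ h x hx) ∘ₗ
    (b.quotKerEquivOfSurjective hb).symm.toLinearMap, fun x ↦ ?_⟩
  have : (b.quotKerEquivOfSurjective hb).symm (b x) = Submodule.Quotient.mk x := by
    rw [LinearEquiv.symm_apply_eq]
    rfl
  rw [LinearMap.comp_apply, LinearEquiv.coe_coe, this]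
  rfl

lemma exists_factor_of_injective {M W J : Type*} [AddCommGroup M] [Module A M] [AddCommGroup W]
    [Module A W] [AddCommGroup J] [Module A J] {j : W →ₗ[A] J} (hj : Function.Injective j)
    (φ : M →ₗ[A] J) (h : ∀ x, φ x ∈ Set.range j) : ∃ φ' : M →ₗ[A] W, ∀ x, j (φ' x) = φ x := by
  refine ⟨(LinearEquiv.ofInjective j hj).symm.toLinearMap ∘ₗ φ.codRestrict _ h, fun x ↦ ?_⟩
  simp only [LinearMap.comp_apply]
  rw [← LinearEquiv.ofInjective_apply j (h := hj), LinearEquiv.coe_coe,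
    LinearEquiv.apply_symm_apply]
  rfl

lemma exists_extend_of_baer {M N J : Type*} [AddCommGroup M] [Module A M] [AddCommGroup N]
    [Module A N] [AddCommGroup J] [Module A J] (hJ : Module.Baer A J) {a : M →ₗ[A] N}
    (ha : Function.Injective a) (φ : M →ₗ[A] J) : ∃ φ' : N →ₗ[A] J, ∀ x, φ' (a x) = φ x := by
  obtain ⟨φ', h⟩ := hJ.extension_property a ha φ
  exact ⟨φ', LinearMap.congr_fun h⟩

lemma LiftsAlong.exists_lift {M J W : Type*} [AddCommGroup M] [Module A M] [AddCommGroup J]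
    [Module A J] [AddCommGroup W] [Module A W] {q : J →ₗ[A] W} (h : LiftsAlong M q)
    (φ : M →ₗ[A] W) : ∃ ψ : M →ₗ[A] J, ∀ x, q (ψ x) = φ x := by
  obtain ⟨ψ, h⟩ := h φ
  exact ⟨ψ, LinearMap.congr_fun h⟩

end Lifting

end Linear

section Cosyzygies

variable {A : Type u} [Ring A]

/-- The first two steps of an injective coresolution of `Z`; the modules `W` and `W'` receive the
first and the second cosyzygy. -/
structure InjectiveCopresentation (Z : Type u) [AddCommGroup Z] [Module A Z] where
  /-- the first injective module -/
  J : ModuleCat.{u} A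
  /-- the first cosyzygy -/
  W : ModuleCat.{u} A
  /-- the second injective module -/
  J' : ModuleCat.{u} A
  /-- the second cosyzygy -/
  W' : ModuleCat.{u} A
  /-- the embedding of the module -/
  i : Z →ₗ[A] J
  /-- the projection onto the first cosyzygy -/
  q : J →ₗ[A] W
  /-- the embedding of the first cosyzygy -/
  j : W →ₗ[A] J'
  /-- the projection onto the second cosyzygy -/
  q' : J' →ₗ[A] W'
  baer : Module.Baer A J
  baer' : Module.Baer A J'
  i_injective : Function.Injective i
  exact_i_q : Function.Exact i q
  q_surjective : Function.Surjective q
  j_injective : Function.Injective j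
  exact_j_q' : Function.Exact j q'
  q'_surjective : Function.Surjective q'

lemma exists_baer_embedding (Z : Type u) [AddCommGroup Z] [Module A Z] :
    ∃ (J : ModuleCat.{u} A) (i : Z →ₗ[A] J), Module.Baer A J ∧ Function.Injective i := by
  refine ⟨Injective.under (ModuleCat.of A Z), (Injective.ι (ModuleCat.of A Z)).hom, ?_, ?_⟩
  · refine Module.Baer.of_injective ?_
    rw [Module.injective_iff_injective_object]
    exact Injective.injective_under _
  · exact (ModuleCat.mono_iff_injective _).1 inferInstance

lemma nonempty_injectiveCopresentation (Z : Type u) [AddCommGroup Z] [Module A Z] :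
    Nonempty (InjectiveCopresentation (A := A) Z) := by
  obtain ⟨J, i, hJ, hi⟩ := exists_baer_embedding (A := A) Z
  obtain ⟨J', j, hJ', hj⟩ := exists_baer_embedding (A := A) (J ⧸ LinearMap.range i)
  exact ⟨{
    J := J
    W := ModuleCat.of A (J ⧸ LinearMap.range i)
    J' := J'
    W' := ModuleCat.of A (J' ⧸ LinearMap.range j)
    i := i
    q := (LinearMap.range i).mkQ
    j := j
    q' := (LinearMap.range j).mkQ
    baer := hJ
    baer' := hJ'
    i_injective := hi
    exact_i_q := LinearMap.exact_map_mkQ_range i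
    q_surjective := Submodule.mkQ_surjective _
    j_injective := hj
    exact_j_q' := LinearMap.exact_map_mkQ_range j
    q'_surjective := Submodule.mkQ_surjective _ }⟩

lemma Ext1Zero.exists_section {M N : ModuleCat.{u} A} (h : Ext1Zero M N) {E : Type u}
    [AddCommGroup E] [Module A E] {i : N →ₗ[A] E} {p : E →ₗ[A] M} (hi : Function.Injective i)
    (hip : Function.Exact i p) (hp : Function.Surjective p) :
    ∃ s : M →ₗ[A] E, ∀ x, p (s x) = x := by
  have w : ModuleCat.ofHom i ≫ ModuleCat.ofHom p = 0 := by
    ext x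
    exact hip.apply_apply_eq_zero x
  obtain ⟨s, hs⟩ := h (ModuleCat.of A E) (ModuleCat.ofHom i) (ModuleCat.ofHom p) w
    { exact := (ShortComplex.ShortExact.moduleCat_exact_iff_function_exact _).2 hip
      mono_f := (ModuleCat.mono_iff_injective _).2 hi
      epi_g := (ModuleCat.epi_iff_surjective _).2 hp }
  exact ⟨s.hom, fun x ↦ congrArg (fun g ↦ g.hom x) hs⟩

lemma ext1Zero_of_liftsAlong {M Z : ModuleCat.{u} A} (r : InjectiveCopresentation (A := A) Z)
    (h : LiftsAlong M r.q) : Ext1Zero M Z := by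
  intro E i p w hse
  have hi : Function.Injective i.hom := hse.moduleCat_injective_f
  have hp : Function.Surjective p.hom := hse.moduleCat_surjective_g
  have hip : Function.Exact i.hom p.hom :=
    (ShortComplex.ShortExact.moduleCat_exact_iff_function_exact _).1 hse.exact
  obtain ⟨u, hu⟩ := exists_extend_of_baer r.baer hi r.i
  obtain ⟨t, ht⟩ := exists_factor_of_surjective hp (r.q ∘ₗ u) (by
    intro x hx
    obtain ⟨z, rfl⟩ := (hip x).1 hx
    rw [LinearMap.comp_apply, hu, r.exact_i_q.apply_apply_eq_zero])
  obtain ⟨t', ht'⟩ := h.exists_lift t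
  obtain ⟨ρ, hρ⟩ := exists_factor_of_injective r.i_injective (u - t' ∘ₗ p.hom) (by
    intro x
    refine (r.exact_i_q _).1 ?_
    simp [ht', ht])
  have hρi : ∀ z, ρ (i.hom z) = z := fun z ↦ by
    apply r.i_injective
    simp [hρ, hu, hip.apply_apply_eq_zero]
  obtain ⟨s, hs⟩ := exists_factor_of_surjective hp (LinearMap.id - i.hom ∘ₗ ρ) (by
    intro x hx
    obtain ⟨z, rfl⟩ := (hip x).1 hx
    simp [hρi])
  refine ⟨ModuleCat.ofHom s, ?_⟩
  ext y
  obtain ⟨x, rfl⟩ := hp y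
  simp [hs, hip.apply_apply_eq_zero]

lemma liftsAlong_of_ext1Zero {M Z : ModuleCat.{u} A} (r : InjectiveCopresentation (A := A) Z)
    (h : Ext1Zero M Z) : LiftsAlong M r.q := by
  intro φ
  let E : Submodule A (M × r.J) :=
    LinearMap.ker (φ ∘ₗ LinearMap.fst A M r.J - r.q ∘ₗ LinearMap.snd A M r.J)
  have hE : ∀ x, x ∈ E ↔ φ x.1 = r.q x.2 := fun x ↦ by
    simp [E, LinearMap.mem_ker, sub_eq_zero]
  obtain ⟨s, hs⟩ := h.exists_section
    (i := (LinearMap.inr A M r.J ∘ₗ r.i).codRestrict E (fun z ↦ by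
      simp [hE, r.exact_i_q.apply_apply_eq_zero]))
    (p := LinearMap.fst A M r.J ∘ₗ E.subtype)
    (fun x y hxy ↦ r.i_injective (congrArg (fun e ↦ e.1.2) hxy))
    (by
      rintro ⟨⟨m, y⟩, hmy⟩
      rw [hE] at hmy
      constructor
      · rintro (rfl : m = 0)
        obtain ⟨z, rfl⟩ := (r.exact_i_q y).1 (by simpa using hmy.symm)
        exact ⟨z, rfl⟩
      · rintro ⟨z, hz⟩
        exact (congrArg (fun e ↦ e.1.1) hz).symm)
    (fun m ↦ by
      obtain ⟨y, hy⟩ := r.q_surjective (φ m)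
      exact ⟨⟨(m, y), (hE _).2 hy.symm⟩, rfl⟩)
  refine ⟨LinearMap.snd A M r.J ∘ₗ E.subtype ∘ₗ s, ?_⟩
  ext x
  have := (hE _).1 (s x).2
  rw [show (s x).1.1 = x from hs x] at this
  exact this.symm

/-- Dimension shifting in the first argument. -/
lemma liftsAlong_q'_of_shortExact {Z : Type u} [AddCommGroup Z] [Module A Z]
    (r : InjectiveCopresentation (A := A) Z)
    {K F C : Type*} [AddCommGroup K] [Module A K] [AddCommGroup F] [Module A F] [AddCommGroup C]
    [Module A C] {a : K →ₗ[A] F} {b : F →ₗ[A] C} (ha : Function.Injective a)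
    (hab : Function.Exact a b) (hb : Function.Surjective b) (hK : LiftsAlong K r.q)
    (hF : LiftsAlong F r.q') : LiftsAlong C r.q' := by
  intro φ
  obtain ⟨g, hg⟩ := hF.exists_lift (φ ∘ₗ b)
  obtain ⟨k, hk⟩ := exists_factor_of_injective r.j_injective (g ∘ₗ a) (by
    intro x
    refine (r.exact_j_q' _).1 ?_
    simp [hg, hab.apply_apply_eq_zero])
  obtain ⟨l, hl⟩ := hK.exists_lift k
  obtain ⟨e, he⟩ := exists_extend_of_baer r.baer ha l
  obtain ⟨ψ, hψ⟩ := exists_factor_of_surjective hb (g - r.j ∘ₗ r.q ∘ₗ e) (by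
    intro x hx
    obtain ⟨z, rfl⟩ := (hab x).1 hx
    simp [he, hl, hk])
  refine ⟨ψ, ?_⟩
  ext y
  obtain ⟨x, rfl⟩ := hb y
  simp [hψ, hg, r.exact_j_q'.apply_apply_eq_zero]

/-- Dimension shifting in the second argument along `0 → Z → X → Y → 0`. -/
lemma liftsAlong_q_of_shortExact {C X : ModuleCat.{u} A} (hCX : Ext1Zero C X) {Z Y : Type u}
    [AddCommGroup Z] [Module A Z] [AddCommGroup Y] [Module A Y]
    (r : InjectiveCopresentation (A := A) Z) (r' : InjectiveCopresentation (A := A) Y)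
    {a : Z →ₗ[A] X} {d : X →ₗ[A] Y} (had : Function.Exact a d) (hd : Function.Surjective d)
    (ha : Function.Injective a) (hC : LiftsAlong C r.q') : LiftsAlong C r'.q := by
  intro f
  let E : Submodule A (C × r'.J) :=
    LinearMap.ker (f ∘ₗ LinearMap.fst A C r'.J - r'.q ∘ₗ LinearMap.snd A C r'.J)
  have hE : ∀ x, x ∈ E ↔ f x.1 = r'.q x.2 := fun x ↦ by
    simp [E, LinearMap.mem_ker, sub_eq_zero]
  let ι : Y →ₗ[A] E := (LinearMap.inr A C r'.J ∘ₗ r'.i).codRestrict E (fun z ↦ by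
      simp [hE, r'.exact_i_q.apply_apply_eq_zero])
  have hι : Function.Injective ι := fun x y hxy ↦
    r'.i_injective (congrArg (fun e ↦ e.1.2) hxy)
  let pr : E →ₗ[A] C := LinearMap.fst A C r'.J ∘ₗ E.subtype
  have hpr : Function.Surjective pr := fun m ↦ by
    obtain ⟨y, hy⟩ := r'.q_surjective (f m)
    exact ⟨⟨(m, y), (hE _).2 hy.symm⟩, rfl⟩
  have hιpr : Function.Exact ι pr := by
    rintro ⟨⟨m, y⟩, hmy⟩
    rw [hE] at hmy
    constructor
    · rintro (rfl : m = 0)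
      obtain ⟨z, rfl⟩ := (r'.exact_i_q y).1 (by simpa using hmy.symm)
      exact ⟨z, rfl⟩
    · rintro ⟨z, hz⟩
      exact (congrArg (fun e ↦ e.1.1) hz).symm
  obtain ⟨u, hu⟩ := exists_extend_of_baer r.baer ha r.i
  obtain ⟨v, hv⟩ := exists_factor_of_surjective hd (r.q ∘ₗ u) (by
    intro x hx
    obtain ⟨z, rfl⟩ := (had x).1 hx
    simp [hu, r.exact_i_q.apply_apply_eq_zero])
  obtain ⟨w, hw⟩ := exists_extend_of_baer r.baer' hι (r.j ∘ₗ v)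
  obtain ⟨t, ht⟩ := exists_factor_of_surjective hpr (r.q' ∘ₗ w) (by
    intro x hx
    obtain ⟨z, rfl⟩ := (hιpr x).1 hx
    simp [hw, r.exact_j_q'.apply_apply_eq_zero])
  obtain ⟨t', ht'⟩ := hC.exists_lift t
  obtain ⟨m, hm⟩ := exists_factor_of_injective r.j_injective (w - t' ∘ₗ pr) (by
    intro x
    refine (r.exact_j_q' _).1 ?_
    simp [ht', ht])
  have hmι : ∀ y, m (ι y) = v y := fun y ↦ by
    apply r.j_injective
    simp [hm, hw, hιpr.apply_apply_eq_zero]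
  let E' : Submodule A (E × r.J) :=
    LinearMap.ker (m ∘ₗ LinearMap.fst A E r.J - r.q ∘ₗ LinearMap.snd A E r.J)
  have hE' : ∀ x, x ∈ E' ↔ m x.1 = r.q x.2 := fun x ↦ by
    simp [E', LinearMap.mem_ker, sub_eq_zero]
  let i' : X →ₗ[A] E' :=
    (LinearMap.prod (ι ∘ₗ d) u).codRestrict E' (fun x ↦ by simp [hE', hmι, hv])
  let p' : E' →ₗ[A] C := pr ∘ₗ LinearMap.fst A E r.J ∘ₗ E'.subtype
  have hi' : Function.Injective i' := by
    rw [injective_iff_map_eq_zero]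
    intro x hx
    have h₁ : ι (d x) = 0 := congrArg (fun e ↦ e.1.1) hx
    have h₂ : u x = 0 := congrArg (fun e ↦ e.1.2) hx
    obtain ⟨z, rfl⟩ := (had x).1 ((map_eq_zero_iff ι hι).1 h₁)
    rw [hu, map_eq_zero_iff r.i r.i_injective] at h₂
    rw [h₂, map_zero]
  have hip' : Function.Exact i' p' := by
    rintro ⟨⟨e, y⟩, hey⟩
    rw [hE'] at hey
    constructor
    · intro (he : pr e = 0)
      obtain ⟨y₀, rfl⟩ := (hιpr e).1 he
      obtain ⟨x, rfl⟩ := hd y₀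
      obtain ⟨z, hz⟩ := (r.exact_i_q (y - u x)).1 (by
        rw [map_sub, ← hey]
        simp [hmι, hv])
      refine ⟨x + a z, Subtype.ext (Prod.ext ?_ ?_)⟩
      · change ι (d (x + a z)) = ι (d x)
        rw [map_add, had.apply_apply_eq_zero, add_zero]
      · change u (x + a z) = y
        rw [map_add, hu, hz, add_sub_cancel]
    · rintro ⟨x, hx⟩
      have : ι (d x) = e := congrArg (fun e ↦ e.1.1) hx
      change pr e = 0
      rw [← this, hιpr.apply_apply_eq_zero]
  have hp' : Function.Surjective p' := by
    intro c
    obtain ⟨e, rfl⟩ := hpr c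
    obtain ⟨y, hy⟩ := r.q_surjective (m e)
    exact ⟨⟨(e, y), (hE' _).2 hy.symm⟩, rfl⟩
  obtain ⟨s, hs⟩ := hCX.exists_section (E := E') hi' hip' hp'
  refine ⟨LinearMap.snd A C r'.J ∘ₗ E.subtype ∘ₗ LinearMap.fst A E r.J ∘ₗ E'.subtype ∘ₗ s, ?_⟩
  ext c
  have := (hE _).1 (s c).1.1.2
  rw [show (s c).1.1.1.1 = c from hs c] at this
  exact this.symm

end Cosyzygies

section DirectedUnions

lemma exists_small_directed_closure (α : Type u) [Preorder α] [IsDirectedOrder α] :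
    ∃ cl : Set α → Set α, Monotone cl ∧ (∀ s, s ⊆ cl s) ∧ (∀ s, DirectedOn (· ≤ ·) (cl s)) ∧
      ∀ s, Cardinal.mk (cl s) ≤ max Cardinal.aleph0 (Cardinal.mk s) := by
  choose ub hub₁ hub₂ using fun a b : α ↦ exists_ge_ge a b
  let step : Set α → ℕ → Set α := fun s n ↦
    Nat.rec s (fun _ t ↦ t ∪ (fun p : α × α ↦ ub p.1 p.2) '' (t ×ˢ t)) n
  have step_succ : ∀ s n, step s (n + 1) =
      step s n ∪ (fun p : α × α ↦ ub p.1 p.2) '' (step s n ×ˢ step s n) := fun _ _ ↦ rfl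
  have step_mono : ∀ s, Monotone (step s) := fun s ↦
    monotone_nat_of_le_succ fun n ↦ by
      rw [step_succ]
      exact Set.subset_union_left
  refine ⟨fun s ↦ ⋃ n : ULift.{u} ℕ, step s n.down, ?_, ?_, ?_, ?_⟩
  · intro s t hst
    refine Set.iUnion_mono fun ⟨n⟩ ↦ ?_
    induction n with
    | zero => exact hst
    | succ n ih =>
      rw [step_succ, step_succ]
      exact Set.union_subset_union ih (Set.image_mono (Set.prod_mono ih ih))
  · exact fun s ↦ Set.subset_iUnion (fun n : ULift.{u} ℕ ↦ step s n.down) ⟨0⟩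
  · intro s a ha b hb
    obtain ⟨⟨m⟩, hm⟩ := Set.mem_iUnion.1 ha
    obtain ⟨⟨n⟩, hn⟩ := Set.mem_iUnion.1 hb
    refine ⟨ub a b, Set.mem_iUnion.2 ⟨⟨max m n + 1⟩, ?_⟩, hub₁ a b, hub₂ a b⟩
    exact Or.inr ⟨(a, b), ⟨step_mono s (le_max_left m n) hm, step_mono s (le_max_right m n) hn⟩,
      rfl⟩
  · intro s
    have hω : Cardinal.aleph0 ≤ max Cardinal.aleph0 (Cardinal.mk s) := le_max_left _ _
    have hstep : ∀ n, Cardinal.mk ↥(step s n) ≤ max Cardinal.aleph0 (Cardinal.mk s) := by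
      intro n
      induction n with
      | zero => exact le_max_right _ _
      | succ n ih =>
        rw [step_succ]
        refine (Cardinal.mk_union_le _ _).trans (Cardinal.add_le_of_le hω ih ?_)
        refine Cardinal.mk_image_le.trans ?_
        rw [Cardinal.mk_setProd]
        simpa using Cardinal.mul_le_of_le hω ih ih
    refine (Cardinal.mk_iUnion_le _).trans (Cardinal.mul_le_of_le hω ?_ ?_)
    · simp
    · exact ciSup_le' fun n ↦ hstep n.down

variable {I : Type u} [Preorder I]

lemma directedOn_biUnion_of_monotone {L : Type*} [LinearOrder L] {T : L → Set I}
    (hT : Monotone T) (hd : ∀ α, DirectedOn (· ≤ ·) (T α)) (s : Set L) :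
    DirectedOn (· ≤ ·) (⋃ α ∈ s, T α) := by
  intro a ha b hb
  simp only [Set.mem_iUnion] at ha hb
  obtain ⟨α, hα, ha⟩ := ha
  obtain ⟨β, hβ, hb⟩ := hb
  have hmax : max α β ∈ s := by
    rcases max_choice α β with h | h <;> rwa [h]
  obtain ⟨c, hc, hac, hbc⟩ := hd _ a (hT (le_max_left α β) ha) b (hT (le_max_right α β) hb)
  exact ⟨c, by simp only [Set.mem_iUnion]; exact ⟨_, hmax, hc⟩, hac, hbc⟩

/-- Iwamura's lemma: an uncountable directed set is the union of a well-ordered chain of directed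
subsets of smaller cardinality. -/
lemma exists_chain_of_uncountable {T : Set I} (hT : DirectedOn (· ≤ ·) T)
    (hcard : Cardinal.aleph0 < Cardinal.mk T) :
    ∃ (L : Type u) (_ : LinearOrder L) (_ : WellFoundedLT L) (U : L → Set I), Monotone U ∧
      (∀ α, DirectedOn (· ≤ ·) (U α)) ∧ (⋃ α, U α) = T ∧
      (∀ α, Cardinal.mk (U α) < Cardinal.mk T) ∧
      ∀ γ, Cardinal.mk (⋃ α ∈ Set.Iio γ, U α : Set I) < Cardinal.mk T := by
  have : IsDirectedOrder T := ⟨fun a b ↦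
    let ⟨c, hc, hac, hbc⟩ := hT a a.2 b b.2
    ⟨⟨c, hc⟩, hac, hbc⟩⟩
  obtain ⟨cl, cl_mono, subset_cl, cl_dir, cl_card⟩ := exists_small_directed_closure T
  let L := (Cardinal.mk T).ord.ToType
  obtain ⟨e⟩ : Nonempty (L ≃ T) := Cardinal.eq.1 (Cardinal.mk_ord_toType _)
  have hIio : ∀ γ : L, Cardinal.mk (Set.Iio γ) < Cardinal.mk T := fun γ ↦ by
    have := Cardinal.mk_Iio_lt γ (by simp [L])
    rwa [Cardinal.mk_ord_toType] at this
  have hIic : ∀ γ : L, Cardinal.mk (Set.Iic γ) < Cardinal.mk T := fun γ ↦ by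
    rw [← Set.Iio_union_right]
    refine (Cardinal.mk_union_le _ _).trans_lt (Cardinal.add_lt_of_lt hcard.le (hIio γ) ?_)
    rw [Cardinal.mk_singleton]
    exact Cardinal.one_lt_aleph0.trans hcard
  have hsmall : ∀ s : Set L, Cardinal.mk s < Cardinal.mk T →
      Cardinal.mk (Subtype.val '' cl (e '' s)) < Cardinal.mk T := fun s hs ↦
    (Cardinal.mk_image_le.trans (cl_card _)).trans_lt
      (max_lt hcard (Cardinal.mk_image_le.trans_lt hs))
  refine ⟨L, inferInstance, inferInstance, fun α ↦ Subtype.val '' cl (e '' Set.Iic α), ?_, ?_, ?_,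
    fun α ↦ hsmall _ (hIic α), fun γ ↦ ?_⟩
  · intro α β h
    exact Set.image_mono (cl_mono (Set.image_mono (Set.Iic_subset_Iic.2 h)))
  · rintro α _ ⟨a, ha, rfl⟩ _ ⟨b, hb, rfl⟩
    obtain ⟨c, hc, hac, hbc⟩ := cl_dir _ a ha b hb
    exact ⟨c, ⟨c, hc, rfl⟩, hac, hbc⟩
  · apply Set.Subset.antisymm
    · refine Set.iUnion_subset fun α ↦ ?_
      rintro _ ⟨a, -, rfl⟩
      exact a.2
    · intro i hi
      refine Set.mem_iUnion.2 ⟨e.symm ⟨i, hi⟩, ⟨i, hi⟩, subset_cl _ ⟨_, Set.mem_Iic.2 le_rfl, ?_⟩,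
        rfl⟩
      simp
  · refine (Cardinal.mk_le_mk_of_subset ?_).trans_lt (hsmall _ (hIio γ))
    refine Set.iUnion₂_subset fun α hα ↦ Set.image_mono (cl_mono (Set.image_mono ?_))
    exact Set.Iic_subset_Iio.2 hα

lemma exists_chain_of_countable {T : Set I} (hT : DirectedOn (· ≤ ·) T) (hne : T.Nonempty)
    (hcount : T.Countable) :
    ∃ s : ℕ → I, Monotone s ∧ (∀ n, s n ∈ T) ∧ ∀ i ∈ T, ∃ n, i ≤ s n := by
  have := hcount.to_subtype
  have : Encodable T := Encodable.ofCountable T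
  have : Inhabited T := ⟨⟨hne.some, hne.some_mem⟩⟩
  have hd : Directed (· ≤ ·) (Subtype.val : T → I) := hT.directed_val
  exact ⟨_, hd.sequence_mono, fun n ↦ (hd.sequence _ n).2, fun i hi ↦ ⟨_, hd.le_sequence ⟨i, hi⟩⟩⟩

end DirectedUnions

section DirectedInduction

variable {A : Type*} [Ring A] {I : Type*} [Preorder I] {G : I → Type*}
  [∀ i, AddCommGroup (G i)] [∀ i, Module A (G i)] (f : ∀ i j, i ≤ j → G i →ₗ[A] G j)

open Classical in
/-- The colimit of the restriction of a direct system to a set of indices. -/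
abbrev LimitOn (T : Set I) : Type _ :=
  Module.DirectLimit (fun i : T ↦ G i) (fun i j (h : i ≤ j) ↦ f i j h)

open Classical in
/-- The homomorphism from a term of the direct system to the colimit over `T`. -/
noncomputable def LimitOn.of {T : Set I} {i : I} (hi : i ∈ T) : G i →ₗ[A] LimitOn f T :=
  Module.DirectLimit.of A T (fun i : T ↦ G i) (fun i j (h : i ≤ j) ↦ f i j h) ⟨i, hi⟩

lemma LimitOn.of_f {T : Set I} {i j : I} (hi : i ∈ T) (hj : j ∈ T) (h : i ≤ j) (x : G i) :
    LimitOn.of f hj (f i j h x) = LimitOn.of f hi x := by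
  classical
  exact Module.DirectLimit.of_f (i := (⟨i, hi⟩ : T)) (j := ⟨j, hj⟩) (hij := h)

lemma LimitOn.hom_ext {T : Set I} {P : Type*} [AddCommGroup P] [Module A P]
    {g₁ g₂ : LimitOn f T →ₗ[A] P}
    (h : ∀ i (hi : i ∈ T) x, g₁ (LimitOn.of f hi x) = g₂ (LimitOn.of f hi x)) : g₁ = g₂ := by
  classical
  exact Module.DirectLimit.hom_ext fun i ↦ LinearMap.ext (h i i.2)

lemma LimitOn.exists_desc {T : Set I} {P : Type*} [AddCommGroup P] [Module A P]
    {φ : ∀ i, i ∈ T → G i →ₗ[A] P}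
    (hφ : ∀ i (hi : i ∈ T) j (hj : j ∈ T) (h : i ≤ j) x, φ j hj (f i j h x) = φ i hi x) :
    ∃ g : LimitOn f T →ₗ[A] P, ∀ i (hi : i ∈ T) x, g (LimitOn.of f hi x) = φ i hi x := by
  classical
  refine ⟨Module.DirectLimit.lift A T _ _ (fun i ↦ φ i i.2) fun i j h x ↦ hφ i i.2 j j.2 h x,
    fun i hi x ↦ ?_⟩
  rw [LimitOn.of]
  exact Module.DirectLimit.lift_of (ι := T) (G := fun i ↦ G i) (f := fun i j h ↦ f i j h)
    (i := ⟨i, hi⟩) (fun i ↦ φ i i.2) _ x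

variable {J W J' W' : Type*} [AddCommGroup J] [Module A J] [AddCommGroup W] [Module A W]
  [AddCommGroup J'] [Module A J'] [AddCommGroup W'] [Module A W']

lemma LimitOn.exists_cocone {T : Set I} (g : LimitOn f T →ₗ[A] W) :
    ∃ φ : ∀ i, G i →ₗ[A] W, IsCoconeOn f T φ ∧
      ∀ i (hi : i ∈ T) x, φ i x = g (LimitOn.of f hi x) := by
  classical
  have key : ∀ i (hi : i ∈ T) x, (if hi : i ∈ T then g ∘ₗ LimitOn.of f hi else 0) x =
      g (LimitOn.of f hi x) := fun i hi x ↦ by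
    simp [hi]
  refine ⟨fun i ↦ if hi : i ∈ T then g ∘ₗ LimitOn.of f hi else 0, ?_, key⟩
  intro i hi j hj h x
  rw [key j hj, key i hi, LimitOn.of_f]

lemma liftsAlong_limitOn_iff {T : Set I} {q : J →ₗ[A] W} :
    LiftsAlong (LimitOn f T) q ↔ LiftsOn f T q := by
  constructor
  · intro h φ hφ
    obtain ⟨g, hg⟩ := LimitOn.exists_desc f (φ := fun i _ ↦ φ i) hφ
    obtain ⟨g', hg'⟩ := h.exists_lift g
    obtain ⟨ψ, hψ, hψg⟩ := LimitOn.exists_cocone f g'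
    refine ⟨ψ, hψ, fun i hi x ↦ ?_⟩
    rw [hψg i hi, hg', hg]
  · intro h g
    obtain ⟨φ, hφ, hφg⟩ := LimitOn.exists_cocone f g
    obtain ⟨ψ, hψ, hψφ⟩ := h φ hφ
    obtain ⟨g', hg'⟩ := LimitOn.exists_desc f (φ := fun i _ ↦ ψ i) hψ
    refine ⟨g', LimitOn.hom_ext f fun i hi x ↦ ?_⟩
    rw [LinearMap.comp_apply, hg', hψφ i hi, hφg i hi]

lemma liftsOn_of_isGreatest {T : Set I} {m : I} (hm : IsGreatest T m)
    (f_comp : ∀ i j k (hij : i ≤ j) (hjk : j ≤ k) x,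
      f j k hjk (f i j hij x) = f i k (hij.trans hjk) x)
    {q : J →ₗ[A] W} (h : LiftsAlong (G m) q) : LiftsOn f T q := by
  rw [← liftsAlong_limitOn_iff]
  intro g
  obtain ⟨ψ, hψ⟩ := h.exists_lift (g ∘ₗ LimitOn.of f hm.1)
  obtain ⟨g', hg'⟩ := LimitOn.exists_desc f (φ := fun i hi ↦ ψ ∘ₗ f i m (hm.2 hi))
    (fun i hi j hj hij x ↦ by simp [f_comp])
  refine ⟨g', LimitOn.hom_ext f fun i hi x ↦ ?_⟩
  simp only [LinearMap.comp_apply, hg', hψ]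
  rw [LimitOn.of_f]

/-- The homomorphism between colimits induced by an inclusion of sets of indices. -/
noncomputable def LimitOn.map {T U : Set I} (hTU : T ⊆ U) : LimitOn f T →ₗ[A] LimitOn f U :=
  (LimitOn.exists_desc f (φ := fun _ hi ↦ LimitOn.of f (hTU hi))
    fun _ _ _ _ h x ↦ LimitOn.of_f f _ _ h x).choose

lemma LimitOn.map_of {T U : Set I} (hTU : T ⊆ U) {i : I} (hi : i ∈ T) (x : G i) :
    LimitOn.map f hTU (LimitOn.of f hi x) = LimitOn.of f (hTU hi) x :=
  (LimitOn.exists_desc f (φ := fun _ hi ↦ LimitOn.of f (hTU hi))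
    fun _ _ _ _ h x ↦ LimitOn.of_f f _ _ h x).choose_spec i hi x

section Union

variable {L : Type*} [LinearOrder L] {T : L → Set I}

lemma exists_cocone_of_cocone_limitOn (hT : Monotone T) {s : Set L}
    {Φ : ∀ α, LimitOn f (T α) →ₗ[A] W}
    (hΦ : IsCoconeOn (fun _ _ h ↦ LimitOn.map f (hT h)) s Φ) :
    ∃ φ : ∀ i, G i →ₗ[A] W, IsCoconeOn f (⋃ α ∈ s, T α) φ ∧
      ∀ α ∈ s, ∀ i (hi : i ∈ T α) x, φ i x = Φ α (LimitOn.of f hi x) := by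
  classical
  have hle : ∀ α ∈ s, ∀ β ∈ s, α ≤ β → ∀ i (hα : i ∈ T α) (hβ : i ∈ T β) x,
      Φ α (LimitOn.of f hα x) = Φ β (LimitOn.of f hβ x) := fun α hαs β hβs h i hα hβ x ↦ by
    rw [← hΦ α hαs β hβs h, LimitOn.map_of]
  let φ : ∀ i, G i →ₗ[A] W := fun i ↦
    if h : ∃ α ∈ s, i ∈ T α then Φ h.choose ∘ₗ LimitOn.of f h.choose_spec.2 else 0
  have hφ : ∀ α ∈ s, ∀ i (hi : i ∈ T α) x, φ i x = Φ α (LimitOn.of f hi x) :=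
    fun α hα i hi x ↦ by
      have h : ∃ α ∈ s, i ∈ T α := ⟨α, hα, hi⟩
      simp only [φ, dif_pos h, LinearMap.comp_apply]
      rcases le_total α h.choose with h' | h'
      · exact (hle _ hα _ h.choose_spec.1 h' _ _ _ _).symm
      · exact hle _ h.choose_spec.1 _ hα h' _ _ _ _
  refine ⟨φ, ?_, hφ⟩
  intro i hi j hj h x
  simp only [Set.mem_iUnion] at hi hj
  obtain ⟨α, hα, hi⟩ := hi
  obtain ⟨β, hβ, hj⟩ := hj
  have hmax : max α β ∈ s := by
    rcases max_choice α β with h | h <;> rwa [h]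
  rw [hφ _ hmax j (hT (le_max_right α β) hj), hφ _ hmax i (hT (le_max_left α β) hi),
    LimitOn.of_f]

lemma exists_cocone_limitOn (hT : Monotone T) {s : Set L} {φ : ∀ i, G i →ₗ[A] W}
    (hφ : IsCoconeOn f (⋃ α ∈ s, T α) φ) :
    ∃ Φ : ∀ α, LimitOn f (T α) →ₗ[A] W, IsCoconeOn (fun _ _ h ↦ LimitOn.map f (hT h)) s Φ ∧
      ∀ α ∈ s, ∀ i (hi : i ∈ T α) x, Φ α (LimitOn.of f hi x) = φ i x := by
  have key : ∀ α, ∃ Φ : LimitOn f (T α) →ₗ[A] W, α ∈ s →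
      ∀ i (hi : i ∈ T α) x, Φ (LimitOn.of f hi x) = φ i x := by
    intro α
    by_cases hα : α ∈ s
    · have hsub : T α ⊆ ⋃ α ∈ s, T α := Set.subset_biUnion_of_mem hα
      obtain ⟨Φ, hΦ⟩ := LimitOn.exists_desc f (T := T α) (φ := fun i _ ↦ φ i)
        fun i hi j hj h x ↦ hφ i (hsub hi) j (hsub hj) h x
      exact ⟨Φ, fun _ ↦ hΦ⟩
    · exact ⟨0, fun h ↦ absurd h hα⟩
  choose Φ hΦ using key
  refine ⟨Φ, ?_, hΦ⟩
  intro α hα β hβ h x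
  refine LinearMap.congr_fun (f := Φ β ∘ₗ LimitOn.map f (hT h))
    (LimitOn.hom_ext f fun i hi x ↦ ?_) x
  rw [LinearMap.comp_apply, LimitOn.map_of, hΦ β hβ, hΦ α hα]

lemma liftsOn_limitOn_iff (hT : Monotone T) {s : Set L} {q : J →ₗ[A] W} :
    LiftsOn (fun _ _ h ↦ LimitOn.map f (hT h)) s q ↔ LiftsOn f (⋃ α ∈ s, T α) q := by
  constructor
  · intro h φ hφ
    obtain ⟨Φ, hΦ, hΦφ⟩ := exists_cocone_limitOn f hT hφ
    obtain ⟨Ψ, hΨ, hΨΦ⟩ := h Φ hΦ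
    obtain ⟨ψ, hψ, hψΨ⟩ := exists_cocone_of_cocone_limitOn f hT hΨ
    refine ⟨ψ, hψ, fun i hi x ↦ ?_⟩
    simp only [Set.mem_iUnion] at hi
    obtain ⟨α, hα, hi⟩ := hi
    rw [hψΨ α hα i hi, hΨΦ α hα, hΦφ α hα]
  · intro h Φ hΦ
    obtain ⟨φ, hφ, hφΦ⟩ := exists_cocone_of_cocone_limitOn f hT hΦ
    obtain ⟨ψ, hψ, hψφ⟩ := h φ hφ
    obtain ⟨Ψ, hΨ, hΨψ⟩ := exists_cocone_limitOn f hT hψ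
    refine ⟨Ψ, hΨ, fun α hα x ↦ ?_⟩
    refine LinearMap.congr_fun (f := q ∘ₗ Ψ α) (LimitOn.hom_ext f fun i hi x ↦ ?_) x
    rw [LinearMap.comp_apply, hΨψ α hα i hi, hψφ i (Set.mem_biUnion hα hi), hφΦ α hα i hi]

lemma liftsOn_iUnion [WellFoundedLT L] (hT : Monotone T) {q : J →ₗ[A] W}
    (hJ : Module.Baer A J) {j : W →ₗ[A] J'} {q' : J' →ₗ[A] W'}
    (hj : Function.Injective j) (hjq : Function.Exact j q')
    (h : ∀ γ, LiftsOn f (⋃ α ∈ Set.Iio γ, T α) q) (h' : ∀ α, LiftsOn f (T α) q') :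
    LiftsOn f (⋃ α, T α) q' := by
  rw [← Set.biUnion_univ, ← liftsOn_limitOn_iff f hT]
  refine liftsOn_chain _ ?_ ?_ hJ hj hjq (fun γ ↦ (liftsOn_limitOn_iff f hT).2 (h γ))
    fun α ↦ (liftsAlong_limitOn_iff f).2 (h' α)
  · intro α
    refine LinearMap.congr_fun (g := LinearMap.id) (LimitOn.hom_ext f fun i hi x ↦ ?_)
    rw [LimitOn.map_of, LinearMap.id_apply]
  · intro α β γ hαβ hβγ
    refine LinearMap.congr_fun (f := LimitOn.map f (hT hβγ) ∘ₗ LimitOn.map f (hT hαβ))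
      (LimitOn.hom_ext f fun i hi x ↦ ?_)
    simp only [LinearMap.comp_apply, LimitOn.map_of]

end Union

end DirectedInduction

section CocycleInduction

variable {A : Type u} [Ring A]

lemma liftsOn_empty {I : Type*} [Preorder I] {G : I → Type*} [∀ i, AddCommGroup (G i)]
    [∀ i, Module A (G i)] (f : ∀ i j, i ≤ j → G i →ₗ[A] G j) {J W : Type*} [AddCommGroup J]
    [Module A J] [AddCommGroup W] [Module A W] (q : J →ₗ[A] W) : LiftsOn f ∅ q :=
  fun _ _ ↦ ⟨0, fun _ h ↦ h.elim, fun _ h ↦ h.elim⟩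

variable {I : Type u} [Preorder I] {G : I → Type*} [∀ i, AddCommGroup (G i)]
  [∀ i, Module A (G i)] (f : ∀ i j, i ≤ j → G i →ₗ[A] G j)

/-- Vanishing of `Ext¹` and `Ext²` into a sequence of modules passes from the terms of a direct
system to its colimit, provided that `Ext²` into each module controls `Ext¹` into the next. -/
lemma liftsOn_of_directedOn
    (f_comp : ∀ i j k (hij : i ≤ j) (hjk : j ≤ k) x,
      f j k hjk (f i j hij x) = f i k (hij.trans hjk) x)
    {Z : ℤ → Type u} [∀ n, AddCommGroup (Z n)] [∀ n, Module A (Z n)]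
    (r : ∀ n, InjectiveCopresentation (A := A) (Z n))
    (hq : ∀ i n, LiftsAlong (G i) (r n).q) (hq' : ∀ i n, LiftsAlong (G i) (r n).q')
    (hshift : ∀ T : Set I, T.Nonempty → DirectedOn (· ≤ ·) T → ∀ n, LiftsOn f T (r n).q' →
      LiftsOn f T (r (n + 1)).q)
    {T : Set I} (hT : DirectedOn (· ≤ ·) T) (n : ℤ) :
    LiftsOn f T (r n).q ∧ LiftsOn f T (r n).q' := by
  induction hκ : Cardinal.mk T using WellFoundedLT.induction generalizing T n with
  | ind κ ih =>
  subst hκ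
  rcases T.eq_empty_or_nonempty with rfl | hne
  · exact ⟨liftsOn_empty f _, liftsOn_empty f _⟩
  suffices key : ∀ n, LiftsOn f T (r n).q' by
    refine ⟨?_, key n⟩
    obtain ⟨m, rfl⟩ : ∃ m, n = m + 1 := ⟨n - 1, by ring⟩
    exact hshift T hne hT m (key m)
  intro n
  rcases le_or_gt (Cardinal.mk T) Cardinal.aleph0 with hcard | hcard
  · obtain ⟨s, hs, hsT, hcof⟩ :=
      exists_chain_of_countable hT hne (Cardinal.le_aleph0_iff_set_countable.1 hcard)
    have hU : Monotone fun k ↦ {i ∈ T | i ≤ s k} := fun k l h i hi ↦ ⟨hi.1, hi.2.trans (hs h)⟩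
    have hgreatest : ∀ k, IsGreatest {i ∈ T | i ≤ s k} (s k) := fun k ↦
      ⟨⟨hsT k, le_rfl⟩, fun i hi ↦ hi.2⟩
    have hunion : T = ⋃ k, {i ∈ T | i ≤ s k} := by
      ext i
      simp only [Set.mem_iUnion, Set.mem_sep_iff, exists_and_left]
      exact ⟨fun hi ↦ ⟨hi, hcof i hi⟩, fun hi ↦ hi.1⟩
    rw [hunion]
    refine liftsOn_iUnion f hU (q := (r n).q) (r n).baer (r n).j_injective (r n).exact_j_q' ?_
      fun k ↦ liftsOn_of_isGreatest f (hgreatest k) f_comp (hq' _ n)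
    rintro (_ | k)
    · simpa using liftsOn_empty f (r n).q
    · have : ⋃ l ∈ Set.Iio (k + 1), {i ∈ T | i ≤ s l} = {i ∈ T | i ≤ s k} :=
        Set.Subset.antisymm (Set.iUnion₂_subset fun l hl ↦ hU (Nat.lt_succ_iff.1 hl))
          (Set.subset_biUnion_of_mem (u := fun l ↦ {i ∈ T | i ≤ s l}) (Nat.lt_succ_self k))
      rw [this]
      exact liftsOn_of_isGreatest f (hgreatest k) f_comp (hq _ n)
  · obtain ⟨L, _, _, U, hU, hdir, hunion, hlt, hlt'⟩ := exists_chain_of_uncountable hT hcard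
    rw [← hunion]
    exact liftsOn_iUnion f hU (r n).baer (r n).j_injective (r n).exact_j_q'
      (fun γ ↦ (ih _ (hlt' γ) (directedOn_biUnion_of_monotone hU hdir _) n rfl).1)
      fun α ↦ (ih _ (hlt α) (hdir α) n rfl).2

end CocycleInduction

section Modules

variable {A : Type u} [Ring A] {S : Set (ModuleCat.{u} A)}

lemma limitOn_mem_limClosure {I : Type u} [PartialOrder I] (F : I ⥤ ModuleCat.{u} A)
    (hF : ∀ i, F.obj i ∈ S) {T : Set I} (hne : T.Nonempty) (hT : DirectedOn (· ≤ ·) T) :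
    ModuleCat.of A (LimitOn (fun i j (h : i ≤ j) ↦ (F.map (homOfLE h)).hom) T) ∈
      limClosure S := by
  classical
  have : IsDirectedOrder T := ⟨fun a b ↦
    let ⟨c, hc, hac, hbc⟩ := hT a a.2 b b.2
    ⟨⟨c, hc⟩, hac, hbc⟩⟩
  have : DirectedSystem (fun i : T ↦ F.obj i)
      fun i j (h : i ≤ j) ↦ (F.map (homOfLE (show i.1 ≤ j from h))).hom :=
    { map_self := fun i x ↦ by
        change (F.map (𝟙 i.1)).hom x = x
        simp
      map_map := fun {k j i} hij hjk x ↦ by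
        rw [← LinearMap.comp_apply, ← ModuleCat.hom_comp, ← F.map_comp]
        rfl }
  exact ⟨{
    I := T
    dir := inferInstance
    ne := hne.to_subtype
    F := ModuleCat.directLimitDiagram _ _
    mem := fun i ↦ hF i
    c := ModuleCat.directLimitCocone (fun i : T ↦ F.obj i)
      fun i j (h : i ≤ j) ↦ (F.map (homOfLE (show i.1 ≤ j from h))).hom
    hc := ModuleCat.directLimitIsColimit _ _
    iso := Iso.refl _ }⟩

lemma finFunction_mem (hfree : ModuleCat.of A A ∈ S) (hsummands : ClosedUnderDirectSummands S)
    (hext : ClosedUnderExtensions S) (n : ℕ) : ModuleCat.of A (Fin n → A) ∈ S := by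
  induction n with
  | zero =>
    refine hsummands _ hfree _ 0 0 ?_
    exact ModuleCat.hom_ext (LinearMap.ext fun x ↦ Subsingleton.elim _ _)
  | succ n ih =>
    let a : A →ₗ[A] (Fin (n + 1) → A) := LinearMap.single A (fun _ ↦ A) 0
    let b : (Fin (n + 1) → A) →ₗ[A] (Fin n → A) := LinearMap.funLeft A A Fin.succ
    have ha : Function.Injective a := fun x y h ↦ by simpa [a] using congrFun h 0
    have hb : Function.Surjective b := LinearMap.funLeft_surjective_of_injective _ _ _
      (Fin.succ_injective n)
    have hab : Function.Exact a b := by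
      intro x
      constructor
      · intro hx
        refine ⟨x 0, funext fun i ↦ ?_⟩
        refine Fin.cases (by simp [a]) (fun i ↦ ?_) i
        have := congrFun hx i
        simp_all [a, b, LinearMap.funLeft_apply]
      · rintro ⟨y, rfl⟩
        ext i
        simp [a, b, LinearMap.funLeft_apply]
    have w : ModuleCat.ofHom a ≫ ModuleCat.ofHom b = 0 :=
      ModuleCat.hom_ext (LinearMap.ext hab.apply_apply_eq_zero)
    exact hext (ShortComplex.mk (ModuleCat.ofHom a) (ModuleCat.ofHom b) w)
      { exact := (ShortComplex.ShortExact.moduleCat_exact_iff_function_exact _).2 hab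
        mono_f := (ModuleCat.mono_iff_injective _).2 ha
        epi_g := (ModuleCat.epi_iff_surjective _).2 hb } hfree ih

lemma liftsAlong_q'_of_finite (hfree : ModuleCat.of A A ∈ S)
    (hsummands : ClosedUnderDirectSummands S) (hext : ClosedUnderExtensions S)
    (hker : ClosedUnderKernelsOfEpis S) {M Z : ModuleCat.{u} A} (hM : M ∈ S)
    [Module.Finite A M] (hZ : Z ∈ rightPerp S) (r : InjectiveCopresentation (A := A) Z) :
    LiftsAlong M r.q' := by
  obtain ⟨n, b, hb⟩ := Module.Finite.exists_fin' A M
  have hK : ModuleCat.of A (LinearMap.ker b) ∈ S := by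
    have w : ModuleCat.ofHom (LinearMap.ker b).subtype ≫ ModuleCat.ofHom b = 0 :=
      ModuleCat.hom_ext (LinearMap.ext fun x ↦ x.2)
    exact hker (ShortComplex.mk (ModuleCat.ofHom (LinearMap.ker b).subtype) (ModuleCat.ofHom b) w)
      { exact := (ShortComplex.ShortExact.moduleCat_exact_iff_function_exact _).2
          (LinearMap.exact_subtype_ker_map b)
        mono_f := (ModuleCat.mono_iff_injective _).2 (Submodule.subtype_injective _)
        epi_g := (ModuleCat.epi_iff_surjective _).2 hb }
      (finFunction_mem hfree hsummands hext n) hM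
  exact liftsAlong_q'_of_shortExact r (Submodule.subtype_injective _)
    (LinearMap.exact_subtype_ker_map b) hb (liftsAlong_of_ext1Zero r (hZ _ hK))
    fun φ ↦ Module.projective_lifting_property r.q' φ r.q'_surjective

lemma liftsAlong_of_liftsOn_univ {I : Type u} [PartialOrder I] {F : I ⥤ ModuleCat.{u} A}
    {c : Cocone F} (hc : IsColimit c) {M : ModuleCat.{u} A} (e : c.pt ≅ M) {J W : Type u}
    [AddCommGroup J] [Module A J] [AddCommGroup W] [Module A W] {q : J →ₗ[A] W}
    (h : LiftsOn (fun i j (h : i ≤ j) ↦ (F.map (homOfLE h)).hom) Set.univ q) :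
    LiftsAlong M q := by
  intro φ
  obtain ⟨ψ, hψ, hψφ⟩ := h (fun i ↦ φ ∘ₗ e.hom.hom ∘ₗ (c.ι.app i).hom) (fun i _ j _ hij x ↦ by
    have := congrArg (fun g ↦ g.hom x) (c.w (homOfLE hij))
    simp only [ModuleCat.hom_comp, LinearMap.comp_apply] at this ⊢
    rw [this])
  let d : Cocone F :=
    { pt := ModuleCat.of A J
      ι :=
        { app := fun i ↦ ModuleCat.ofHom (ψ i)
          naturality := fun i j g ↦ by
            ext x
            exact hψ i trivial j trivial (leOfHom g) x } }
  refine ⟨(e.inv ≫ hc.desc d).hom, ?_⟩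
  have key : hc.desc d ≫ ModuleCat.ofHom q = e.hom ≫ ModuleCat.ofHom φ := by
    refine hc.hom_ext fun i ↦ ?_
    rw [hc.fac_assoc]
    ext x
    exact hψφ i trivial x
  have : e.inv ≫ hc.desc d ≫ ModuleCat.ofHom q = ModuleCat.ofHom φ := by
    rw [key, e.inv_hom_id_assoc]
  exact congrArg ModuleCat.Hom.hom this

/-- The short exact sequence `0 → Zⁿ → Xⁿ → Zⁿ⁺¹ → 0` of an acyclic complex. -/
lemma kernel_shortExact {X : CochainComplex (ModuleCat.{u} A) ℤ} (hX : IsAcyclic X) (n : ℤ) :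
    ∃ (a : (kernel (X.d n (n + 1)) : ModuleCat.{u} A) →ₗ[A] X.X n)
      (d : X.X n →ₗ[A] (kernel (X.d (n + 1) (n + 1 + 1)) : ModuleCat.{u} A)),
      Function.Injective a ∧ Function.Exact a d ∧ Function.Surjective d := by
  have w : X.d n (n + 1) ≫ X.d (n + 1) (n + 1 + 1) = 0 := X.d_comp_d _ _ _
  have hlift : kernel.lift _ _ w ≫ kernel.ι _ = X.d n (n + 1) := kernel.lift_ι _ _ _
  have hepi : Epi (kernel.lift _ _ w) := by
    have := (HomologicalComplex.exactAt_iff' X n (n + 1) (n + 1 + 1) (by simp) (by simp)).1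
      (hX (n + 1))
    exact (ShortComplex.exact_iff_epi_kernel_lift _).1 this
  refine ⟨(kernel.ι (X.d n (n + 1))).hom, (kernel.lift _ _ w).hom,
    (ModuleCat.mono_iff_injective _).1 inferInstance, ?_,
    (ModuleCat.epi_iff_surjective _).1 hepi⟩
  have hw : kernel.ι (X.d n (n + 1)) ≫ kernel.lift _ _ w = 0 := by
    rw [← cancel_mono (kernel.ι (X.d (n + 1) (n + 1 + 1))), Category.assoc, hlift,
      kernel.condition, zero_comp]
  refine (ShortComplex.ShortExact.moduleCat_exact_iff_function_exact
    (ShortComplex.mk _ _ hw)).1 ?_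
  refine ShortComplex.exact_of_f_is_kernel _ (KernelFork.IsLimit.ofι _ _
    (fun g hg ↦ kernel.lift _ g (by
      rw [← hlift, reassoc_of% hg, zero_comp])) (fun g hg ↦ kernel.lift_ι _ _ _)
    fun g hg m hm ↦ by rw [← cancel_mono (kernel.ι _), hm, kernel.lift_ι])

end Modules

theorem statement5 {R : Type u} [Ring R] (S : Set (ModuleCat.{u} Rᵐᵒᵖ))
    (hsfp : ∀ M ∈ S, StronglyFinitelyPresented M)
    (hfree : ModuleCat.of Rᵐᵒᵖ Rᵐᵒᵖ ∈ S)
    (hsummands : ClosedUnderDirectSummands S)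
    (hext : ClosedUnderExtensions S)
    (hker : ClosedUnderKernelsOfEpis S)
    (B C D : Set (ModuleCat.{u} Rᵐᵒᵖ))
    (hB : B = rightPerp S) (hC : C = limClosure S) (hD : D = rightPerp C)
    (X : CochainComplex (ModuleCat.{u} Rᵐᵒᵖ) ℤ)
    (hacyclic : IsAcyclic X)
    (hterms : ∀ n : ℤ, X.X n ∈ D)
    (hcocycles : ∀ n : ℤ, kernel (X.d n (n + 1)) ∈ B) :
    ∀ n : ℤ, kernel (X.d n (n + 1)) ∈ D := by
  subst hB hC hD
  have hfin : ∀ M ∈ S, Module.Finite Rᵐᵒᵖ M := fun M hM ↦ by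
    obtain ⟨P, _, ε, _, _, _, hP, hε, _⟩ := hsfp M hM
    have := hP 0
    exact Module.Finite.of_surjective ε.hom ((ModuleCat.epi_iff_surjective _).1 hε)
  have r : ∀ n : ℤ, InjectiveCopresentation (A := Rᵐᵒᵖ)
      (kernel (X.d n (n + 1)) : ModuleCat.{u} Rᵐᵒᵖ) :=
    fun n ↦ (nonempty_injectiveCopresentation _).some
  rintro n M ⟨Y⟩
  let := Y.po
  have := Y.dir
  refine ext1Zero_of_liftsAlong (r n) (liftsAlong_of_liftsOn_univ Y.hc Y.iso ?_)
  refine (liftsOn_of_directedOn _ ?_ r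
    (fun i m ↦ liftsAlong_of_ext1Zero (r m) (hcocycles m _ (Y.mem i)))
    (fun i m ↦ ?_) ?_ (directedOn_univ) n).1
  · intro i j k hij hjk x
    rw [← LinearMap.comp_apply, ← ModuleCat.hom_comp, ← Y.F.map_comp]
    rfl
  · have := hfin _ (Y.mem i)
    exact liftsAlong_q'_of_finite hfree hsummands hext hker (Y.mem i) (hcocycles m) (r m)
  · intro T hne hT m hm
    rw [← liftsAlong_limitOn_iff] at hm ⊢
    obtain ⟨a, d, ha, had, hd⟩ := kernel_shortExact hacyclic m
    exact liftsAlong_q_of_shortExact (hterms m _ (limitOn_mem_limClosure Y.F Y.mem hne hT))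
      (r m) (r (m + 1)) had hd ha hm

end GenPeriodicity
end

section
/- Let κ be a regular cardinal, K a locally κ-presentable category, and S ⊆ K a class of κ-presentable objects. Then: the class lim→^{(κ)} S of all κ-direct limits of objects from S is closed under κ-direct limits in K; an object L ∈ K belongs to lim→^{(κ)} S if and only if every morphism T → L from a κ-presentable object T factorizes through an object of S; and if S is closed under coproducts indexed by sets of cardinality < κ, then lim→^{(κ)} S is closed under all coproducts in K. -/
open CategoryTheory CategoryTheory.Limits

universe w v u

namespace GenPeriodicity

variable {K : Type u} [Category.{v} K]

/-- A preorder is `κ`-directed if every subset of cardinality `< κ` has an upper bound. -/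
def KappaDirected (κ : Cardinal.{v}) (I : Type v) [Preorder I] : Prop :=
  ∀ s : Set I, Cardinal.mk s < κ → ∃ j : I, ∀ i ∈ s, i ≤ j

/-- An object `S` is `κ`-presentable if `Hom(S, −)` preserves `κ`-direct limits,
here expressed concretely. -/
def KappaPresentableObj (κ : Cardinal.{v}) (S : K) : Prop :=
  ∀ (I : Type v) [PartialOrder I], KappaDirected κ I →
    ∀ (F : I ⥤ K) (c : Cocone F), IsColimit c →
      (∀ f : S ⟶ c.pt, ∃ (i : I) (g : S ⟶ F.obj i), g ≫ c.ι.app i = f) ∧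
      (∀ (i : I) (g g' : S ⟶ F.obj i), g ≫ c.ι.app i = g' ≫ c.ι.app i →
        ∃ (j : I) (h : i ≤ j), g ≫ F.map (homOfLE h) = g' ≫ F.map (homOfLE h))

/-- Data exhibiting `M` as a `κ`-direct limit of objects from `S`. -/
structure KappaDirectSystemTo (κ : Cardinal.{v}) (S : Set K) (M : K) where
  I : Type v
  [po : PartialOrder I]
  dir : KappaDirected κ I
  F : I ⥤ K
  mem : ∀ i, F.obj i ∈ S
  c : Cocone F
  hc : IsColimit c
  iso : c.pt ≅ M

/-- `lim→^{(κ)} S`: the class of all `κ`-direct limits of diagrams of objects of `S`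
indexed by `κ`-directed posets. -/
def kappaLimClosure (κ : Cardinal.{v}) (S : Set K) : Set K :=
  {M | Nonempty (KappaDirectSystemTo κ S M)}

/-- A category is locally `κ`-presentable: it is cocomplete and there is a set of
`κ`-presentable objects such that every object is a `κ`-direct limit of objects
of this set. -/
def LocallyKappaPresentable (κ : Cardinal.{v}) (K : Type u) [Category.{v} K] : Prop :=
  HasColimitsOfSize.{v, v} K ∧
    ∃ (ι : Type v) (G : ι → K), (∀ x, KappaPresentableObj κ (G x)) ∧
      ∀ X : K, X ∈ kappaLimClosure κ (Set.range G)

lemma kappaDirected_iff_isCardinalFiltered (κ : Cardinal.{v}) [Fact κ.IsRegular]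
    (I : Type v) [Preorder I] : KappaDirected κ I ↔ IsCardinalFiltered I κ := by
  refine ⟨fun h ↦ isCardinalFiltered_preorder I κ fun A s hA ↦ ?_, fun _ s hs ↦ ?_⟩
  · obtain ⟨j, hj⟩ := h (Set.range s) (Cardinal.mk_range_le.trans_lt hA)
    exact ⟨j, fun k ↦ hj _ ⟨k, rfl⟩⟩
  · have hs' : HasCardinalLT s κ := by rwa [hasCardinalLT_iff_cardinal_mk_lt]
    exact ⟨IsCardinalFiltered.max (fun i : s ↦ (i : I)) hs', fun i hi ↦
      leOfHom (IsCardinalFiltered.toMax (fun i : s ↦ (i : I)) hs' ⟨i, hi⟩)⟩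

lemma kappaPresentableObj_iff_isCardinalPresentable (κ : Cardinal.{v}) [Fact κ.IsRegular]
    (X : K) : KappaPresentableObj κ X ↔ IsCardinalPresentable X κ := by
  refine ⟨fun h ↦ ⟨fun J _ _ ↦ ⟨fun {F} ↦ ⟨fun {c} hc ↦ ?_⟩⟩⟩, fun _ I _ hI F c hc ↦ ?_⟩
  · obtain ⟨α, _, hα, p, _⟩ := IsCardinalFiltered.exists_cardinal_directed J κ
    have := isFiltered_of_isCardinalFiltered α κ
    obtain ⟨h₁, h₂⟩ := h α ((kappaDirected_iff_isCardinalFiltered κ α).2 hα) (p ⋙ F)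
      (c.whisker p) ((Functor.Final.isColimitWhiskerEquiv p c).symm hc)
    refine ⟨Functor.Final.isColimitWhiskerEquiv p _
      (Types.FilteredColimit.isColimitOf' _ _ (fun f ↦ ?_) fun i g g' hg ↦ ?_)⟩
    · obtain ⟨i, g, hg⟩ := h₁ f
      exact ⟨i, g, hg.symm⟩
    · obtain ⟨j, hij, e⟩ := h₂ i g g' hg
      exact ⟨j, homOfLE hij, e⟩
  · have := (kappaDirected_iff_isCardinalFiltered κ I).1 hI
    refine ⟨fun f ↦ IsCardinalPresentable.exists_hom_of_isColimit κ hc f, fun i g g' hg ↦ ?_⟩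
    obtain ⟨j, u, hu⟩ := IsCardinalPresentable.exists_eq_of_isColimit' κ hc g g' hg
    exact ⟨j, leOfHom u, hu⟩

lemma LocallyKappaPresentable.isCardinalLocallyPresentable {κ : Cardinal.{v}}
    [Fact κ.IsRegular] (h : LocallyKappaPresentable κ K) :
    IsCardinalLocallyPresentable K κ := by
  obtain ⟨_, ι, G, hG, hK⟩ := h
  have hP : (ObjectProperty.ofObj G).IsCardinalFilteredGenerator κ :=
    { le_isCardinalPresentable := by
        rintro _ ⟨x⟩
        exact (kappaPresentableObj_iff_isCardinalPresentable κ _).1 (hG x)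
      exists_colimitsOfShape := fun X ↦ by
        obtain ⟨D⟩ := hK X
        let := D.po
        refine ⟨D.I, inferInstance, (kappaDirected_iff_isCardinalFiltered κ D.I).1 D.dir, ⟨?_⟩⟩
        exact
          { diag := D.F
            ι := D.c.ι ≫ (Functor.const D.I).map D.iso.hom
            isColimit := D.hc.ofIsoColimit (Cocone.ext D.iso)
            prop_diag_obj := fun i ↦ by
              obtain ⟨x, hx⟩ := D.mem i
              rw [← hx]
              exact ⟨x⟩ } }
  have := hP.hasCardinalFilteredGenerator
  exact { }

lemma isCardinalFiltered_of_fullyFaithful {C : Type*} [Category* C] {D : Type*} [Category* D]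
    (F : C ⥤ D) [F.Full] [F.Faithful] (κ : Cardinal.{w}) [Fact κ.IsRegular]
    [IsCardinalFiltered D κ] (h : ∀ d, ∃ c, Nonempty (d ⟶ F.obj c)) :
    IsCardinalFiltered C κ where
  nonempty_cocone G hA := by
    let s := IsCardinalFiltered.cocone (G ⋙ F) hA
    obtain ⟨c, ⟨f⟩⟩ := h s.pt
    exact ⟨⟨c, { app a := F.preimage (s.ι.app a ≫ f)
                 naturality a b g := F.map_injective (by
                  simpa using s.w_assoc g f) }⟩⟩

lemma exists_factorization_of_mem_kappaLimClosure {κ : Cardinal.{v}} {S : Set K} {L : K}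
    (hL : L ∈ kappaLimClosure κ S) {T : K} (hT : KappaPresentableObj κ T) (f : T ⟶ L) :
    ∃ s ∈ S, ∃ (g : T ⟶ s) (h : s ⟶ L), g ≫ h = f := by
  obtain ⟨D⟩ := hL
  let := D.po
  obtain ⟨i, g, hg⟩ := (hT D.I D.dir D.F D.c D.hc).1 (f ≫ D.iso.inv)
  exact ⟨_, D.mem i, g, D.c.ι.app i ≫ D.iso.hom, by
    rw [← Category.assoc, hg, Category.assoc, Iso.inv_hom_id, Category.comp_id]⟩

lemma mem_kappaLimClosure_of_exists_factorization {κ : Cardinal.{v}} [Fact κ.IsRegular]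
    [IsCardinalLocallyPresentable K κ] {S : Set K} (hS : ∀ X ∈ S, KappaPresentableObj κ X)
    {L : K} (hL : ∀ T : K, KappaPresentableObj κ T → ∀ f : T ⟶ L,
      ∃ s ∈ S, ∃ (g : T ⟶ s) (h : s ⟶ L), g ≫ h = f) :
    L ∈ kappaLimClosure κ S := by
  let P : ObjectProperty (CostructuredArrow (isCardinalPresentable K κ).ι L) :=
    fun X ↦ X.left.obj ∈ S
  have hP (X) : ∃ Y : P.FullSubcategory, Nonempty (X ⟶ P.ι.obj Y) := by
    obtain ⟨s, hs, g, h, e⟩ := hL X.left.obj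
      ((kappaPresentableObj_iff_isCardinalPresentable κ _).2 X.left.property) X.hom
    let s' : (isCardinalPresentable K κ).FullSubcategory :=
      ⟨s, (kappaPresentableObj_iff_isCardinalPresentable κ s).1 (hS s hs)⟩
    exact ⟨⟨CostructuredArrow.mk (show (isCardinalPresentable K κ).ι.obj s' ⟶ L from h), hs⟩,
      ⟨CostructuredArrow.homMk (ObjectProperty.homMk g) e⟩⟩
  have := isFiltered_of_isCardinalFiltered
    (CostructuredArrow (isCardinalPresentable K κ).ι L) κ
  have := isCardinalFiltered_of_fullyFaithful P.ι κ hP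
  have : P.ι.Final := Functor.final_of_exists_of_isFiltered_of_fullyFaithful P.ι hP
  have : EssentiallySmall.{v} P.FullSubcategory :=
    essentiallySmall_of_fully_faithful P.ι
  let e := equivSmallModel.{v} P.FullSubcategory
  have := IsCardinalFiltered.of_equivalence κ e
  obtain ⟨α, _, hα, p, _⟩ :=
    IsCardinalFiltered.exists_cardinal_directed (SmallModel.{v} P.FullSubcategory) κ
  exact ⟨{
    I := α
    dir := (kappaDirected_iff_isCardinalFiltered κ α).2 hα
    F := (p ⋙ e.inverse ⋙ P.ι) ⋙ CostructuredArrow.proj _ _ ⋙ (isCardinalPresentable K κ).ι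
    mem i := (e.inverse.obj (p.obj i)).property
    c := _
    hc := (Functor.Final.isColimitWhiskerEquiv (p ⋙ e.inverse ⋙ P.ι) _).symm
      ((isCardinalPresentable K κ).ι.denseAt L)
    iso := Iso.refl L }⟩

section CoproductOfDirectLimits

variable {B : Type v} {I : B → Type v} [∀ b, PartialOrder (I b)]

/-- The poset indexing the coproducts of `κ`-small subfamilies of a family of direct systems. -/
@[ext]
structure SubfamilyIndex (κ : Cardinal.{v}) (I : B → Type v) : Type v where
  /-- the set of indices of the direct systems in the subfamily -/
  support : Set B
  card_support_lt : Cardinal.mk support < κ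
  /-- a term of each direct system -/
  index : ∀ b, I b

instance (κ : Cardinal.{v}) : PartialOrder (SubfamilyIndex κ I) where
  le p q := p.support ⊆ q.support ∧ p.index ≤ q.index
  le_refl _ := ⟨subset_rfl, le_rfl⟩
  le_trans _ _ _ h h' := ⟨h.1.trans h'.1, h.2.trans h'.2⟩
  le_antisymm _ _ h h' := SubfamilyIndex.ext (h.1.antisymm h'.1) (h.2.antisymm h'.2)

lemma kappaDirected_subfamilyIndex {κ : Cardinal.{v}} (hκ : κ.IsRegular)
    (hI : ∀ b, KappaDirected κ (I b)) : KappaDirected κ (SubfamilyIndex κ I) := by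
  intro s hs
  choose j hj using fun b ↦ hI b ((fun p ↦ p.index b) '' s) (Cardinal.mk_image_le.trans_lt hs)
  refine ⟨⟨⋃ p : s, p.1.support,
    (Cardinal.card_iUnion_lt_iff_forall_of_isRegular hκ hs).2 fun p ↦ p.1.card_support_lt, j⟩, ?_⟩
  exact fun p hp ↦ ⟨Set.subset_iUnion (fun p : s ↦ p.1.support) ⟨p, hp⟩,
    fun b ↦ hj b _ (Set.mem_image_of_mem _ hp)⟩

lemma exists_subfamilyIndex {κ : Cardinal.{v}} (hκ : κ.IsRegular)
    (hI : ∀ b, KappaDirected κ (I b)) (b : B) (i : I b) :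
    ∃ p : SubfamilyIndex κ I, b ∈ p.support ∧ i ≤ p.index b := by
  classical
  choose j _ using fun b ↦ hI b ∅ (by simpa using hκ.pos)
  exact ⟨⟨{b}, by simpa using Cardinal.one_lt_aleph0.trans_le hκ.aleph0_le,
    Function.update j b i⟩, by simp, by simp⟩

variable [HasCoproducts.{v} K] {κ : Cardinal.{v}} {F : ∀ b, I b ⥤ K}

namespace SubfamilyIndex

variable (F) in
/-- The coproduct of the chosen terms of the direct systems in a subfamily. -/
noncomputable def coproduct (p : SubfamilyIndex κ I) : K :=
  ∐ fun b : p.support ↦ (F b).obj (p.index b)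

variable (F) in
/-- The inclusion of a term of a direct system into the coproduct of a subfamily. -/
noncomputable def ι (p : SubfamilyIndex κ I) {b : B} (hb : b ∈ p.support) :
    (F b).obj (p.index b) ⟶ p.coproduct F :=
  Sigma.ι (fun b : p.support ↦ (F b).obj (p.index b)) ⟨b, hb⟩

/-- The morphism from the coproduct of a subfamily given by its components. -/
noncomputable def desc (p : SubfamilyIndex κ I) {Z : K}
    (f : ∀ b ∈ p.support, (F b).obj (p.index b) ⟶ Z) : p.coproduct F ⟶ Z :=
  Limits.Sigma.desc fun b ↦ f b b.2

@[simp]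
lemma ι_desc (p : SubfamilyIndex κ I) {Z : K} (f : ∀ b ∈ p.support, (F b).obj (p.index b) ⟶ Z)
    {b : B} (hb : b ∈ p.support) : p.ι F hb ≫ p.desc f = f b hb :=
  Limits.Sigma.ι_desc _ _

@[simp]
lemma ι_desc_assoc (p : SubfamilyIndex κ I) {Z W : K}
    (f : ∀ b ∈ p.support, (F b).obj (p.index b) ⟶ Z) {b : B} (hb : b ∈ p.support) (g : Z ⟶ W) :
    p.ι F hb ≫ p.desc f ≫ g = f b hb ≫ g := by
  rw [← Category.assoc, ι_desc]

lemma hom_ext {p : SubfamilyIndex κ I} {Z : K} {f g : p.coproduct F ⟶ Z}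
    (h : ∀ b (hb : b ∈ p.support), p.ι F hb ≫ f = p.ι F hb ≫ g) : f = g :=
  Limits.Sigma.hom_ext _ _ fun b ↦ h b.1 b.2

/-- The transition morphisms between the coproducts of subfamilies. -/
noncomputable def map {p q : SubfamilyIndex κ I} (h : p ≤ q) : p.coproduct F ⟶ q.coproduct F :=
  p.desc fun b hb ↦ (F b).map (homOfLE (h.2 b)) ≫ q.ι F (h.1 hb)

@[simp]
lemma ι_map {p q : SubfamilyIndex κ I} (h : p ≤ q) {b : B} (hb : b ∈ p.support) :
    p.ι F hb ≫ map h = (F b).map (homOfLE (h.2 b)) ≫ q.ι F (h.1 hb) :=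
  ι_desc _ _ _

@[simp]
lemma ι_map_assoc {p q : SubfamilyIndex κ I} (h : p ≤ q) {b : B} (hb : b ∈ p.support) {Z : K}
    (g : q.coproduct F ⟶ Z) :
    p.ι F hb ≫ map h ≫ g = (F b).map (homOfLE (h.2 b)) ≫ q.ι F (h.1 hb) ≫ g := by
  rw [← Category.assoc, ι_map, Category.assoc]

end SubfamilyIndex

variable (κ F) in
/-- The diagram of the coproducts of terms of `κ`-small subfamilies of a family of
direct systems. -/
noncomputable abbrev subfamilyCoproduct : SubfamilyIndex κ I ⥤ K where
  obj p := p.coproduct F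
  map f := SubfamilyIndex.map (leOfHom f)
  map_id p := SubfamilyIndex.hom_ext fun b hb ↦ by simp
  map_comp f g := SubfamilyIndex.hom_ext fun b hb ↦ by
    simp [← Functor.map_comp_assoc]

variable (κ) in
/-- The cocone on the coproducts of subfamilies induced by cocones on the direct systems
and a cofan on their points. -/
noncomputable abbrev subfamilyCoproductCocone (s : ∀ b, Cocone (F b))
    (c : Cofan fun b ↦ (s b).pt) : Cocone (subfamilyCoproduct κ F) where
  pt := c.pt
  ι :=
    { app p := p.desc fun b _ ↦ (s b).ι.app (p.index b) ≫ c.inj b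
      naturality p q f := SubfamilyIndex.hom_ext fun b hb ↦ by simp }

lemma exists_hom_of_subfamilyCoproduct_cocone (hκ : κ.IsRegular)
    (hI : ∀ b, KappaDirected κ (I b)) (t : Cocone (subfamilyCoproduct κ F)) (b : B) (i : I b) :
    ∃ φ : (F b).obj i ⟶ t.pt, ∀ (p : SubfamilyIndex κ I) (hb : b ∈ p.support) (h : i ≤ p.index b),
      (F b).map (homOfLE h) ≫ p.ι F hb ≫ t.ι.app p = φ := by
  have : Fact κ.IsRegular := ⟨hκ⟩
  have := (kappaDirected_iff_isCardinalFiltered κ _).1 (kappaDirected_subfamilyIndex hκ hI)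
  have := isFiltered_of_isCardinalFiltered (SubfamilyIndex κ I) κ
  obtain ⟨p₀, hb₀, h₀⟩ := exists_subfamilyIndex hκ hI b i
  have key {p p' : SubfamilyIndex κ I} (f : p ⟶ p') (hb : b ∈ p.support) (h : i ≤ p.index b) :
      (F b).map (homOfLE h) ≫ p.ι F hb ≫ t.ι.app p =
        (F b).map (homOfLE (h.trans ((leOfHom f).2 b))) ≫
          p'.ι F ((leOfHom f).1 hb) ≫ t.ι.app p' := by
    rw [← t.w f, SubfamilyIndex.ι_map_assoc, ← Functor.map_comp_assoc, homOfLE_comp]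
  exact ⟨(F b).map (homOfLE h₀) ≫ p₀.ι F hb₀ ≫ t.ι.app p₀, fun p hb h ↦
    (key (IsFiltered.leftToMax p p₀) hb h).trans (key (IsFiltered.rightToMax p p₀) hb₀ h₀).symm⟩

lemma nonempty_isColimit_subfamilyCoproductCocone (hκ : κ.IsRegular)
    (hI : ∀ b, KappaDirected κ (I b)) {s : ∀ b, Cocone (F b)} (hs : ∀ b, IsColimit (s b))
    {c : Cofan fun b ↦ (s b).pt} (hc : IsColimit c) :
    Nonempty (IsColimit (subfamilyCoproductCocone κ s c)) := by
  choose φ hφ using exists_hom_of_subfamilyCoproduct_cocone (F := F) hκ hI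
  let T (t : Cocone (subfamilyCoproduct κ F)) (b : B) : Cocone (F b) :=
    { pt := t.pt
      ι :=
        { app := φ t b
          naturality i j f := by
            obtain ⟨p, hb, h⟩ := exists_subfamilyIndex hκ hI b j
            have e : homOfLE ((leOfHom f).trans h) = f ≫ homOfLE h := Subsingleton.elim _ _
            rw [← hφ t b j p hb h, ← hφ t b i p hb ((leOfHom f).trans h), e]
            simp } }
  refine ⟨{
    desc t := Cofan.IsColimit.desc hc fun b ↦ (hs b).desc (T t b)
    fac t p := SubfamilyIndex.hom_ext fun b hb ↦ ?_
    uniq t m hm := Cofan.IsColimit.hom_ext hc _ _ fun b ↦ (hs b).hom_ext fun i ↦ ?_ }⟩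
  · rw [SubfamilyIndex.ι_desc_assoc, Category.assoc, Cofan.IsColimit.fac, IsColimit.fac]
    simpa using (hφ t b _ p hb le_rfl).symm
  · obtain ⟨p, hb, h⟩ := exists_subfamilyIndex hκ hI b i
    rw [Cofan.IsColimit.fac, IsColimit.fac]
    change _ = φ t b i
    rw [← hφ t b i p hb h, ← hm p, SubfamilyIndex.ι_desc_assoc, Category.assoc,
      Cocone.w_assoc]

end CoproductOfDirectLimits

lemma coproduct_mem_kappaLimClosure [HasCoproducts.{v} K] {κ : Cardinal.{v}} (hκ : κ.IsRegular)
    {S : Set K} (hS : ∀ (B : Type v), Cardinal.mk B < κ → ∀ (X : B → K), (∀ b, X b ∈ S) →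
      ∀ (c : Cofan X), IsColimit c → c.pt ∈ S)
    {B : Type v} {X : B → K} (hX : ∀ b, X b ∈ kappaLimClosure κ S) {c : Cofan X}
    (hc : IsColimit c) : c.pt ∈ kappaLimClosure κ S := by
  have D (b : B) : KappaDirectSystemTo κ S (X b) := Nonempty.some (hX b)
  let (b : B) : PartialOrder (D b).I := (D b).po
  obtain ⟨h⟩ := nonempty_isColimit_subfamilyCoproductCocone hκ (fun b ↦ (D b).dir)
    (s := fun b ↦ (D b).c.extend (D b).iso.hom) (fun b ↦ (D b).hc.extendIso _) hc
  exact ⟨{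
    I := SubfamilyIndex κ fun b ↦ (D b).I
    dir := kappaDirected_subfamilyIndex hκ fun b ↦ (D b).dir
    F := subfamilyCoproduct κ fun b ↦ (D b).F
    mem p := hS _ p.card_support_lt _ (fun b ↦ (D b).mem _) _ (coproductIsCoproduct _)
    c := _
    hc := h
    iso := Iso.refl _ }⟩

theorem statement17 (κ : Cardinal.{v}) (hκ : κ.IsRegular)
    (hloc : LocallyKappaPresentable κ K)
    (S : Set K) (hS : ∀ X ∈ S, KappaPresentableObj κ X) :
    (∀ (I : Type v) [PartialOrder I], KappaDirected κ I →
      ∀ (F : I ⥤ K), (∀ i, F.obj i ∈ kappaLimClosure κ S) →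
        ∀ (c : Cocone F), IsColimit c → c.pt ∈ kappaLimClosure κ S) ∧
    (∀ L : K, L ∈ kappaLimClosure κ S ↔
      ∀ T : K, KappaPresentableObj κ T → ∀ f : T ⟶ L,
        ∃ s ∈ S, ∃ (g : T ⟶ s) (h : s ⟶ L), g ≫ h = f) ∧
    ((∀ (B : Type v), Cardinal.mk B < κ → ∀ (X : B → K), (∀ b, X b ∈ S) →
        ∀ (c : Cofan X), IsColimit c → c.pt ∈ S) →
      ∀ (B : Type v) (X : B → K), (∀ b, X b ∈ kappaLimClosure κ S) →
        ∀ (c : Cofan X), IsColimit c → c.pt ∈ kappaLimClosure κ S) := by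
  have : Fact κ.IsRegular := ⟨hκ⟩
  have := hloc.isCardinalLocallyPresentable
  have := hloc.1
  refine ⟨fun I _ hI F hF c hc ↦ mem_kappaLimClosure_of_exists_factorization hS fun T hT f ↦ ?_,
    fun L ↦ ⟨fun hL T hT f ↦ exists_factorization_of_mem_kappaLimClosure hL hT f,
      mem_kappaLimClosure_of_exists_factorization hS⟩,
    fun hS' B X hX c hc ↦ coproduct_mem_kappaLimClosure hκ hS' hX hc⟩
  obtain ⟨i, g, rfl⟩ := (hT I hI F c hc).1 f
  obtain ⟨s, hs, g', h, rfl⟩ := exists_factorization_of_mem_kappaLimClosure (hF i) hT g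
  exact ⟨s, hs, g', h ≫ c.ι.app i, (Category.assoc _ _ _).symm⟩

end GenPeriodicity
end

section
/- Let κ be a regular cardinal, K a locally κ-presentable abelian category, and S a class of objects of type κP₂ in K closed under extensions. Then the class lim→^{(κ)} S of all κ-direct limits of objects from S is also closed under extensions in K. -/
open CategoryTheory CategoryTheory.Limits

universe w v u

namespace GenPeriodicity

variable {K : Type u} [Category.{v} K]

section KExtDefs

variable [Abelian K] [HasExt.{w} K]

/-- The functor `Ext^n(S, −)` preserves `κ`-direct limits, expressed concretely. -/
def ExtPreservesKappaDirectLimits (κ : Cardinal.{v}) (n : ℕ) (S : K) : Prop :=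
  ∀ (I : Type v) [PartialOrder I], KappaDirected κ I →
    ∀ (F : I ⥤ K) (c : Cocone F), IsColimit c →
      (∀ e : Abelian.Ext S c.pt n, ∃ (i : I) (e' : Abelian.Ext S (F.obj i) n),
        e'.comp (Abelian.Ext.mk₀ (c.ι.app i)) (add_zero n) = e) ∧
      (∀ (i : I) (e' : Abelian.Ext S (F.obj i) n),
        e'.comp (Abelian.Ext.mk₀ (c.ι.app i)) (add_zero n) = 0 →
        ∃ (j : I) (h : i ≤ j),
          e'.comp (Abelian.Ext.mk₀ (F.map (homOfLE h))) (add_zero n) = 0)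

end KExtDefs

section Effaceable

variable [Abelian K]

open HomologicalComplex in
lemma exists_epi_single_lift {X : K} {L : CochainComplex K ℤ} {i : ℤ}
    (π : L ⟶ (single K (ComplexShape.up ℤ) i).obj X) [L.IsStrictlyLE i] [QuasiIsoAt π i] :
    ∃ (P : K) (p : P ⟶ X) (_ : Epi p) (s : (single K (ComplexShape.up ℤ) i).obj P ⟶ L),
      s ≫ π = (single K (ComplexShape.up ℤ) i).map p := by
  have hL (j : ℤ) (hij : (ComplexShape.up ℤ).Rel i j) {Y : K} (f : Y ⟶ L.X j) : f = 0 := by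
    obtain rfl : i + 1 = j := hij
    exact (L.isZero_of_isStrictlyLE i (i + 1) (by simp)).eq_of_tgt _ _
  let e := L.iCyclesIso i (i + 1) (by simp) (hL _ rfl _)
  let α := e.inv ≫ L.homologyπ i ≫ homologyMap π i ≫ (singleObjHomologySelfIso _ _ _).hom
  have hα : π.f i = α ≫ (singleObjXSelf (ComplexShape.up ℤ) i X).inv := by
    rw [← cancel_epi e.hom]
    dsimp only [α, e]
    rw [Category.assoc, Category.assoc, Category.assoc, iCyclesIso_hom,
      iCyclesIso_hom_inv_id_assoc, homologyπ_naturality_assoc,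
      homologyπ_singleObjHomologySelfIso_hom_assoc,
      ← singleObjCyclesSelfIso_inv_iCycles, Iso.hom_inv_id_assoc, ← cyclesMap_i]
  have : Epi α := by
    dsimp only [α]
    infer_instance
  refine ⟨L.X i, α, this, mkHomFromSingle (𝟙 _) (fun k hk => hL k hk _), ?_⟩
  apply HomologicalComplex.from_single_hom_ext
  rw [comp_f, mkHomFromSingle_f, Category.assoc, hα, Category.id_comp]
  exact (HomologicalComplex.single_map_f_self (ComplexShape.up ℤ) i α).symm

open DerivedCategory in
lemma exists_epi_mk₀_comp_eq_zero [HasExt.{w} K] {X Y : K} {n : ℕ} (e : Abelian.Ext X Y (n + 1)) :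
    ∃ (P : K) (p : P ⟶ X) (_ : Epi p), (Abelian.Ext.mk₀ p).comp e (zero_add _) = 0 := by
  let := HasDerivedCategory.standard K
  let φ : Q.obj ((CochainComplex.singleFunctor K 0).obj X) ⟶
      Q.obj ((CochainComplex.singleFunctor K (-(n + 1))).obj Y) :=
    e.hom ≫ ((singleFunctors K).shiftIso (n + 1) (-(n + 1)) 0 (by lia)).hom.app Y
  obtain ⟨L, _, π, h, g, hφ⟩ := right_fac_of_isStrictlyLE φ 0
  have : QuasiIso π := by rwa [isIso_Q_map_iff_quasiIso] at h
  let π' : L ⟶ (HomologicalComplex.single K (ComplexShape.up ℤ) 0).obj X := π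
  have : QuasiIso π' := this
  obtain ⟨P, p, hp, s, hs⟩ : ∃ (P : K) (p : P ⟶ X) (_ : Epi p)
      (s : (CochainComplex.singleFunctor K 0).obj P ⟶ L),
      s ≫ π = (CochainComplex.singleFunctor K 0).map p := exists_epi_single_lift π'
  refine ⟨P, p, hp, ?_⟩
  have hsg : s ≫ g = 0 := by
    apply HomologicalComplex.from_single_hom_ext
    apply (((CochainComplex.singleFunctor K (-(n + 1))).obj Y).isZero_of_isStrictlyLE
      (-(n + 1)) 0 (by lia)).eq_of_tgt
  apply Abelian.Ext.ext
  rw [Abelian.Ext.comp_hom, Abelian.Ext.mk₀_hom, Abelian.Ext.zero_hom, ShiftedHom.mk₀_comp,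
    ← cancel_mono (((singleFunctors K).shiftIso (n + 1) (-(n + 1)) 0 (by lia)).hom.app Y)]
  have : Q.map ((CochainComplex.singleFunctor K 0).map p) ≫ φ = 0 := by
    rw [hφ, ← hs, Functor.map_comp, Category.assoc, IsIso.hom_inv_id_assoc, ← Functor.map_comp,
      hsg, Functor.map_zero]
  simpa [φ] using! this

end Effaceable

section Pushout

variable [Abelian K]

lemma shortExact_of_isPushout {X : ShortComplex K} (hX : X.ShortExact) {A P : K} {f : X.X₁ ⟶ A}
    {inl : X.X₂ ⟶ P} {inr : A ⟶ P} (sq : IsPushout X.f f inl inr) {π : P ⟶ X.X₃}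
    (hl : inl ≫ π = X.g) (hr : inr ≫ π = 0) : (ShortComplex.mk inr π hr).ShortExact := by
  have := hX.mono_f
  have := hX.epi_g
  have : Epi π := epi_of_epi_fac hl
  have : Mono inr := Abelian.mono_inr_of_isColimit _ _ sq.isColimit
  refine ShortComplex.ShortExact.mk' (ShortComplex.exact_of_g_is_cokernel _ ?_) this ‹Epi π›
  have aux {Z : K} (k : P ⟶ Z) (hk : inr ≫ k = 0) : X.f ≫ inl ≫ k = 0 := by
    rw [sq.w_assoc, hk, comp_zero]
  refine CokernelCofork.IsColimit.ofπ _ _ (fun k hk => hX.exact.desc (inl ≫ k) (aux k hk)) ?_ ?_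
  · intro Z k hk
    apply sq.hom_ext
    · rw [reassoc_of% hl, hX.exact.g_desc]
    · rw [reassoc_of% hr, zero_comp]
      exact hk.symm
  · intro Z k hk m hm
    rw [← cancel_epi X.g, hX.exact.g_desc, ← hm]
    dsimp
    rw [reassoc_of% hl]

lemma shortExact_of_isPullback {X : ShortComplex K} (hX : X.ShortExact) {B P : K} {b : B ⟶ X.X₃}
    {fst : P ⟶ X.X₂} {snd : P ⟶ B} (sq : IsPullback fst snd X.g b) {ι : X.X₁ ⟶ P}
    (hl : ι ≫ fst = X.f) (hr : ι ≫ snd = 0) : (ShortComplex.mk ι snd hr).ShortExact := by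
  have := hX.mono_f
  have := hX.epi_g
  have : Mono ι := mono_of_mono_fac hl
  have : Epi snd := Abelian.epi_snd_of_isLimit _ _ sq.isLimit
  refine ShortComplex.ShortExact.mk' (ShortComplex.exact_of_f_is_kernel _ ?_) ‹Mono ι› this
  have aux {Z : K} (k : Z ⟶ P) (hk : k ≫ snd = 0) : (k ≫ fst) ≫ X.g = 0 := by
    rw [Category.assoc, sq.w, reassoc_of% hk, zero_comp]
  refine KernelFork.IsLimit.ofι _ _ (fun k hk => hX.exact.lift (k ≫ fst) (aux k hk)) ?_ ?_
  · intro Z k hk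
    apply sq.hom_ext
    · rw [Category.assoc, hl, hX.exact.lift_f]
    · rw [Category.assoc, hr, comp_zero]
      exact hk.symm
  · intro Z k hk m hm
    rw [← cancel_mono X.f, hX.exact.lift_f, ← hm, Category.assoc, ← hl]

lemma exists_hom_of_extClass_comp_eq [HasExt.{w} K] {X : ShortComplex K} (hX : X.ShortExact)
    {A E : K} {i : A ⟶ E} {q : E ⟶ X.X₃} (wq : i ≫ q = 0) (hE : (ShortComplex.mk i q wq).ShortExact)
    (f : X.X₁ ⟶ A)
    (h : hX.extClass.comp (Abelian.Ext.mk₀ f) (add_zero 1) = hE.extClass) :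
    ∃ t : X.X₂ ⟶ E, X.f ≫ t = f ≫ i ∧ t ≫ q = X.g := by
  obtain ⟨t₀, ht₀⟩ := Abelian.Ext.contravariant_sequence_exact₁ hX _
    (Abelian.Ext.mk₀ (f ≫ i)) (add_zero 1) (by
      rw [← Abelian.Ext.mk₀_comp_mk₀, ← Abelian.Ext.comp_assoc _ _ _ (add_zero 1) (add_zero 0) rfl,
        h]
      exact hE.extClass_comp)
  obtain ⟨t, rfl⟩ := Abelian.Ext.mk₀_bijective _ _ |>.2 t₀
  rw [Abelian.Ext.mk₀_comp_mk₀] at ht₀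
  replace ht₀ := (Abelian.Ext.mk₀_bijective _ _).1 ht₀
  have := hX.epi_g
  let θ : X.X₃ ⟶ X.X₃ := hX.exact.desc (t ≫ q) (by
    rw [reassoc_of% ht₀, wq, comp_zero])
  have hθ : X.g ≫ θ = t ≫ q := hX.exact.g_desc _ _
  have nat := ShortComplex.ShortExact.extClass_naturality hX hE
    { τ₁ := f, τ₂ := t, τ₃ := θ, comm₁₂ := ht₀.symm, comm₂₃ := hθ.symm }
  dsimp at nat
  obtain ⟨s₀, hs₀⟩ := Abelian.Ext.covariant_sequence_exact₃ _ hE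
    (Abelian.Ext.mk₀ (𝟙 X.X₃ - θ)) (zero_add 1) (by
      rw [sub_eq_add_neg, Abelian.Ext.mk₀_add, Abelian.Ext.mk₀_neg, Abelian.Ext.add_comp,
        Abelian.Ext.neg_comp, ← nat, h]
      simp)
  obtain ⟨s, rfl⟩ := Abelian.Ext.mk₀_bijective _ _ |>.2 s₀
  rw [Abelian.Ext.mk₀_comp_mk₀] at hs₀
  replace hs₀ : s ≫ q = 𝟙 X.X₃ - θ := (Abelian.Ext.mk₀_bijective _ _).1 hs₀
  refine ⟨t + X.g ≫ s, ?_, ?_⟩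
  · simp [ht₀]
  · simp [hs₀, hθ]

lemma isPushout_of_shortExact {X : ShortComplex K} (hX : X.ShortExact)
    {A E : K} {i : A ⟶ E} {q : E ⟶ X.X₃} (wq : i ≫ q = 0) (hE : (ShortComplex.mk i q wq).ShortExact)
    (f : X.X₁ ⟶ A) (t : X.X₂ ⟶ E) (ht : X.f ≫ t = f ≫ i) (htq : t ≫ q = X.g) :
    IsPushout X.f f t i := by
  have sq := IsPushout.of_hasPushout X.f f
  let π := sq.desc X.g 0 (by rw [X.zero, comp_zero])
  let d := sq.desc t i ht
  have hd : d ≫ q = π := by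
    apply sq.hom_ext
    · rw [sq.inl_desc_assoc, htq, sq.inl_desc]
    · rw [sq.inr_desc_assoc, wq, sq.inr_desc]
  let φ : ShortComplex.mk (pushout.inr X.f f) π (sq.inr_desc _ _ _) ⟶ ShortComplex.mk i q wq :=
    { τ₁ := 𝟙 _
      τ₂ := d
      τ₃ := 𝟙 _
      comm₁₂ := by
        dsimp
        rw [Category.id_comp, sq.inr_desc]
      comm₂₃ := by
        dsimp
        rw [Category.comp_id, hd] }
  have h₁ : IsIso φ.τ₁ := inferInstanceAs (IsIso (𝟙 _))
  have h₃ : IsIso φ.τ₃ := inferInstanceAs (IsIso (𝟙 _))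
  have h₂ : IsIso d := ShortComplex.isIso₂_of_shortExact_of_isIso₁₃ φ
    (shortExact_of_isPushout hX sq (sq.inl_desc _ _ _) _) hE
  exact sq.of_iso (Iso.refl _) (Iso.refl _) (Iso.refl _) (asIso d) (by simp) (by simp)
    (by simp [d]) (by simp [d])

end Pushout

section PushoutColimit

variable {J : Type v} [PartialOrder J] {F : J ⥤ K} {Z X : K} {f : Z ⟶ X}

/-- The pushout of a directed colimit is the directed colimit of the pushouts. -/
noncomputable def isColimitOfIsPushout [IsDirectedOrder J] [Nonempty J]
    {γ : ∀ j, Z ⟶ F.obj j} {c : Cocone F} (hc : IsColimit c) {g : Z ⟶ c.pt}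
    (hg : ∀ j, γ j ≫ c.ι.app j = g)
    {P : J ⥤ K} {inl' : ∀ j, X ⟶ P.obj j} {inr' : ∀ j, F.obj j ⟶ P.obj j}
    (sq' : ∀ j, IsPushout f (γ j) (inl' j) (inr' j))
    (inl_map : ∀ {j k : J} (φ : j ⟶ k), inl' j ≫ P.map φ = inl' k)
    (inr_map : ∀ {j k : J} (φ : j ⟶ k), inr' j ≫ P.map φ = F.map φ ≫ inr' k)
    {e : Cocone P} {inl : X ⟶ e.pt} {inr : c.pt ⟶ e.pt} (sq : IsPushout f g inl inr)
    (inl_ι : ∀ j, inl' j ≫ e.ι.app j = inl)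
    (inr_ι : ∀ j, inr' j ≫ e.ι.app j = c.ι.app j ≫ inr) :
    IsColimit e := by
  have inl_eq (s : Cocone P) (j k : J) : inl' j ≫ s.ι.app j = inl' k ≫ s.ι.app k := by
    obtain ⟨l, hj, hk⟩ := exists_ge_ge j k
    rw [← s.w (homOfLE hj), ← s.w (homOfLE hk), reassoc_of% inl_map (homOfLE hj),
      reassoc_of% inl_map (homOfLE hk)]
  let r (s : Cocone P) : Cocone F :=
    { pt := s.pt
      ι :=
        { app j := inr' j ≫ s.ι.app j
          naturality j k φ := by
            dsimp
            rw [Category.comp_id, ← s.w φ, reassoc_of% inr_map φ] } }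
  have r_ι (s : Cocone P) (j : J) : (r s).ι.app j = inr' j ≫ s.ι.app j := rfl
  let j₀ : J := Classical.arbitrary J
  have comm (s : Cocone P) : f ≫ inl' j₀ ≫ s.ι.app j₀ = g ≫ hc.desc (r s) := by
    rw [← hg j₀, Category.assoc, hc.fac, r_ι, (sq' j₀).w_assoc]
  exact
    { desc s := sq.desc (inl' j₀ ≫ s.ι.app j₀) (hc.desc (r s)) (comm s)
      fac s j := by
        apply (sq' j).hom_ext
        · rw [reassoc_of% inl_ι j, sq.inl_desc, inl_eq s j₀ j]
        · rw [reassoc_of% inr_ι j, sq.inr_desc, hc.fac]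
      uniq s m hm := by
        apply sq.hom_ext
        · rw [sq.inl_desc, ← hm j₀, reassoc_of% inl_ι j₀]
        · rw [sq.inr_desc]
          apply hc.hom_ext
          intro j
          rw [hc.fac, ← reassoc_of% inr_ι j, hm j] }

variable [HasPushouts K] {γ : ∀ j, Z ⟶ F.obj j}

/-- The diagram of the pushouts of a morphism `f : Z ⟶ X` along a compatible family of morphisms
from `Z` to the objects of a diagram. -/
noncomputable def pushoutDiagram (f : Z ⟶ X)
    (hγ : ∀ {j k : J} (φ : j ⟶ k), γ j ≫ F.map φ = γ k) : J ⥤ K where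
  obj j := pushout f (γ j)
  map {j k} φ := pushout.desc (pushout.inl f (γ k)) (F.map φ ≫ pushout.inr f (γ k)) (by
    rw [pushout.condition, reassoc_of% hγ φ])
  map_id j := by
    apply pushout.hom_ext <;> simp
  map_comp φ ψ := by
    apply pushout.hom_ext
    · rw [pushout.inl_desc, pushout.inl_desc_assoc, pushout.inl_desc]
    · rw [pushout.inr_desc, pushout.inr_desc_assoc, Category.assoc, pushout.inr_desc, F.map_comp,
        Category.assoc]

/-- The cocone over `pushoutDiagram f hγ` whose point is the pushout of `f` along the induced
morphism to the point of a cocone over `F`. -/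
noncomputable def pushoutCocone (hγ : ∀ {j k : J} (φ : j ⟶ k), γ j ≫ F.map φ = γ k)
    {c : Cocone F} {g : Z ⟶ c.pt} {E : K} {inl : X ⟶ E} {inr : c.pt ⟶ E}
    (hg : ∀ j, γ j ≫ c.ι.app j = g) (sq : IsPushout f g inl inr) :
    Cocone (pushoutDiagram f hγ) where
  pt := E
  ι :=
    { app j := pushout.desc inl (c.ι.app j ≫ inr) (by rw [reassoc_of% hg j, sq.w])
      naturality j k φ := by
        dsimp [pushoutDiagram]
        rw [Category.comp_id]
        apply pushout.hom_ext
        · rw [pushout.inl_desc, pushout.inl_desc_assoc, pushout.inl_desc]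
        · rw [pushout.inr_desc, pushout.inr_desc_assoc, Category.assoc, pushout.inr_desc,
            c.w_assoc] }

end PushoutColimit

section Directed

variable {κ : Cardinal.{v}}

lemma KappaDirected.nonempty (hκ : κ.IsRegular) {I : Type v} [Preorder I]
    (hI : KappaDirected κ I) : Nonempty I := by
  obtain ⟨j, -⟩ := hI ∅ (by simpa using hκ.pos)
  exact ⟨j⟩

lemma KappaDirected.isDirectedOrder (hκ : κ.IsRegular) {I : Type v} [Preorder I]
    (hI : KappaDirected κ I) : IsDirectedOrder I where
  directed i j := by
    obtain ⟨k, hk⟩ := hI {i, j}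
      (((Set.toFinite _).lt_aleph0).trans_le hκ.aleph0_le)
    exact ⟨k, hk i (by simp), hk j (by simp)⟩

lemma KappaDirected.Ici (hκ : κ.IsRegular) {I : Type v} [Preorder I]
    (hI : KappaDirected κ I) (i : I) : KappaDirected κ (Set.Ici i) := by
  have := hI.isDirectedOrder hκ
  intro s hs
  obtain ⟨j, hj⟩ := hI (Subtype.val '' s) (Cardinal.mk_image_le.trans_lt hs)
  obtain ⟨k, hjk, hik⟩ := exists_ge_ge j i
  exact ⟨⟨k, hik⟩, fun x hx => (hj _ ⟨x, hx, rfl⟩).trans hjk⟩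

lemma final_Ici {I : Type v} [PartialOrder I] [IsDirectedOrder I] (i : I)
    [IsDirectedOrder (Set.Ici i)] :
    (Subtype.mono_coe (· ∈ Set.Ici i)).functor.Final := by
  rw [Monotone.final_functor_iff]
  intro x
  obtain ⟨k, hik, hxk⟩ := exists_ge_ge i x
  exact ⟨⟨k, hik⟩, hxk⟩

lemma exists_factor_pushout [HasPushouts K] (hκ : κ.IsRegular) {T : K}
    (hT : KappaPresentableObj κ T) {I : Type v} [PartialOrder I] (hI : KappaDirected κ I)
    {F : I ⥤ K} {c : Cocone F} (hc : IsColimit c) {i : I} {Z X E : K} {f : Z ⟶ X}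
    {g : Z ⟶ F.obj i} {inl : X ⟶ E} {inr : c.pt ⟶ E}
    (sq : IsPushout f (g ≫ c.ι.app i) inl inr) (x : T ⟶ E) :
    ∃ (j : I) (h : i ≤ j) (y : T ⟶ pushout f (g ≫ F.map (homOfLE h)))
      (d : pushout f (g ≫ F.map (homOfLE h)) ⟶ E), y ≫ d = x := by
  have := hI.isDirectedOrder hκ
  have hI' := hI.Ici hκ i
  have := hI'.isDirectedOrder hκ
  have := final_Ici i
  have := hI'.nonempty hκ
  let Φ := (Subtype.mono_coe (· ∈ Set.Ici i)).functor
  let γ (j : Set.Ici i) : Z ⟶ (Φ ⋙ F).obj j := g ≫ F.map (homOfLE j.2)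
  have hγ {j k : Set.Ici i} (φ : j ⟶ k) : γ j ≫ (Φ ⋙ F).map φ = γ k := by
    dsimp [γ]
    rw [Category.assoc, ← F.map_comp]
    rfl
  have hc' : IsColimit (c.whisker Φ) := (Functor.Final.isColimitWhiskerEquiv Φ c).symm hc
  have hg (j : Set.Ici i) : γ j ≫ (c.whisker Φ).ι.app j = g ≫ c.ι.app i := by
    dsimp only [γ]
    rw [Category.assoc]
    exact congrArg (g ≫ ·) (c.w (homOfLE j.2))
  have hP : IsColimit (pushoutCocone hγ hg sq) :=
    isColimitOfIsPushout hc' hg (fun j => IsPushout.of_hasPushout f (γ j))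
      (fun _ => pushout.inl_desc _ _ _) (fun _ => pushout.inr_desc _ _ _) sq
      (fun _ => pushout.inl_desc _ _ _) (fun _ => pushout.inr_desc _ _ _)
  obtain ⟨j, y, hy⟩ := (hT _ hI' _ _ hP).1 x
  exact ⟨j, j.2, y, _, hy⟩

end Directed

section Lazard

variable {κ : Cardinal.{v}}

/-- The order on the index set of a direct system obtained from an inflationary map `n`,
where `j` is strictly below `k` only if `n j ≤ k`. -/
def Sparse {J : Type v} (_ : J → J) : Type v := J

/-- The partial order of `Sparse n`. -/
@[reducible] def Sparse.partialOrder {J : Type v} [PartialOrder J] {n : J → J}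
    (hn : ∀ j, j ≤ n j) : PartialOrder (Sparse n) where
  le (j k : J) := j = k ∨ n j ≤ k
  le_refl j := Or.inl rfl
  le_trans j k l := by
    rintro (rfl | h) (rfl | h')
    · exact Or.inl rfl
    · exact Or.inr h'
    · exact Or.inr h
    · exact Or.inr (h.trans ((hn k).trans h'))
  le_antisymm j k := by
    rintro (h | h) (h' | h')
    · exact h
    · exact h
    · exact h'.symm
    · exact le_antisymm (α := J) ((hn j).trans h) ((hn k).trans h')

lemma KappaDirected.sparse {J : Type v} [PartialOrder J] (hJ : KappaDirected κ J) {n : J → J}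
    (hn : ∀ j, j ≤ n j) : @KappaDirected κ (Sparse n) (Sparse.partialOrder hn).toPreorder := by
  intro s hs
  obtain ⟨k, hk⟩ := hJ (n '' s) (Cardinal.mk_image_le.trans_lt hs)
  exact ⟨k, fun j hj => Or.inr (hk _ ⟨j, hj, rfl⟩)⟩

section

variable {J : Type v} [PartialOrder J] (G : J ⥤ K) {n : J → J} (hn : ∀ j, j ≤ n j)
  {s : J → K} (a : ∀ j, G.obj j ⟶ s j) (r : ∀ j, s j ⟶ G.obj (n j))

open scoped Classical in
/-- The transition morphisms of the direct system interleaved with `G` by means of `a` and `r`. -/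
noncomputable def interleavedMap (j k : J) (h : j = k ∨ n j ≤ k) : s j ⟶ s k :=
  if e : j = k then eqToHom (by rw [e]) else r j ≫ G.map (homOfLE (h.resolve_left e)) ≫ a k

lemma interleavedMap_self (j : J) (h : j = j ∨ n j ≤ j) : interleavedMap G a r j j h = 𝟙 _ := by
  simp [interleavedMap]

lemma interleavedMap_of_ne {j k : J} (e : j ≠ k) (h : n j ≤ k) :
    interleavedMap G a r j k (Or.inr h) = r j ≫ G.map (homOfLE h) ≫ a k := by
  simp [interleavedMap, e]

lemma interleavedMap_comp (har : ∀ j, a j ≫ r j = G.map (homOfLE (hn j))) (j k l : J)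
    (h : j = k ∨ n j ≤ k) (h' : k = l ∨ n k ≤ l) (h'' : j = l ∨ n j ≤ l) :
    interleavedMap G a r j l h'' = interleavedMap G a r j k h ≫ interleavedMap G a r k l h' := by
  by_cases e : j = k
  · subst e
    simp [interleavedMap_self]
  by_cases e' : k = l
  · subst e'
    simp [interleavedMap_self]
  replace h := h.resolve_left e
  replace h' := h'.resolve_left e'
  have e'' : j ≠ l := by
    rintro rfl
    exact e (le_antisymm ((hn j).trans h) ((hn k).trans h'))
  rw [interleavedMap_of_ne G a r e'' (h.trans ((hn k).trans h')), interleavedMap_of_ne G a r e h,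
    interleavedMap_of_ne G a r e' h']
  simp only [Category.assoc, reassoc_of% har k, ← Functor.map_comp_assoc, homOfLE_comp]

lemma comp_interleavedMap (har : ∀ j, a j ≫ r j = G.map (homOfLE (hn j))) (j k : J)
    (hjk : j ≤ k) (h : j = k ∨ n j ≤ k) :
    a j ≫ interleavedMap G a r j k h = G.map (homOfLE hjk) ≫ a k := by
  by_cases e : j = k
  · subst e
    simp [interleavedMap_self]
  · rw [interleavedMap_of_ne G a r e (h.resolve_left e), reassoc_of% har j,
      ← Functor.map_comp_assoc, homOfLE_comp]

/-- The direct system interleaved with `G` by means of `a` and `r`. -/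
noncomputable def interleaved (har : ∀ j, a j ≫ r j = G.map (homOfLE (hn j))) :
    let _ := Sparse.partialOrder hn
    Sparse n ⥤ K :=
  let _ := Sparse.partialOrder hn
  { obj j := s j
    map {j k} φ := interleavedMap G a r j k (leOfHom φ)
    map_id j := interleavedMap_self G a r j _
    map_comp _ _ := interleavedMap_comp G hn a r har _ _ _ _ _ _ }

end

lemma mem_kappaLimClosure_of_factor_of_noMaxOrder (hκ : κ.IsRegular) {S : Set K}
    (hS : ∀ X ∈ S, KappaPresentableObj κ X) {J : Type v} [PartialOrder J] [NoMaxOrder J]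
    (hJ : KappaDirected κ J) {G : J ⥤ K} (hG : ∀ j, KappaPresentableObj κ (G.obj j))
    {c : Cocone G} (hc : IsColimit c)
    (H : ∀ j, ∃ s ∈ S, ∃ (a : G.obj j ⟶ s) (b : s ⟶ c.pt), a ≫ b = c.ι.app j) :
    c.pt ∈ kappaLimClosure κ S := by
  have := hJ.isDirectedOrder hκ
  choose s hs a b hab using H
  have hr (j : J) : ∃ (k : J) (h : j < k) (r : s j ⟶ G.obj k),
      a j ≫ r = G.map (homOfLE h.le) ∧ r ≫ c.ι.app k = b j := by
    obtain ⟨k, r, hr⟩ := (hS _ (hs j) J hJ G c hc).1 (b j)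
    obtain ⟨l, hjl, hkl⟩ := exists_ge_ge j k
    obtain ⟨m, hm, eq⟩ := (hG j J hJ G c hc).2 l (a j ≫ r ≫ G.map (homOfLE hkl))
      (G.map (homOfLE hjl)) (by simp [hr, hab])
    obtain ⟨m', hm'⟩ := exists_gt m
    refine ⟨m', (hjl.trans hm).trans_lt hm',
      r ≫ G.map (homOfLE ((hkl.trans hm).trans hm'.le)), ?_, by simp [hr]⟩
    have eq' := eq =≫ G.map (homOfLE hm'.le)
    simpa [← Functor.map_comp, homOfLE_comp] using eq'
  choose n hn' r har hrb using hr
  have hn (j : J) : j ≤ n j := (hn' j).le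
  let _ := Sparse.partialOrder hn
  let F : Sparse n ⥤ K := interleaved G hn a r har
  let c' : Cocone F :=
    { pt := c.pt
      ι :=
        { app j := b j
          naturality (j k : J) φ := by
            change interleavedMap G a r j k (leOfHom φ) ≫ b k = b j ≫ 𝟙 _
            rw [Category.comp_id]
            by_cases e : j = k
            · subst e
              rw [interleavedMap_self, Category.id_comp]
            · rw [interleavedMap_of_ne G a r e ((leOfHom φ).resolve_left e)]
              simp [hab, hrb] } }
  let τ (t : Cocone F) (j : J) : s j ⟶ t.pt := t.ι.app (j : Sparse n)
  have hτ (t : Cocone F) (j k : J) (h : j = k ∨ n j ≤ k) :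
      interleavedMap G a r j k h ≫ τ t k = τ t j :=
    t.w (@homOfLE (Sparse n) _ j k h)
  have key (t : Cocone F) (j k : J) (h : n j ≤ k) :
      a j ≫ τ t j = G.map (homOfLE ((hn j).trans h)) ≫ a k ≫ τ t k := by
    rw [← hτ t j k (Or.inr h),
      reassoc_of% comp_interleavedMap G hn a r har j k ((hn j).trans h) (Or.inr h)]
  let q (t : Cocone F) : Cocone G :=
    { pt := t.pt
      ι :=
        { app j := a j ≫ τ t j
          naturality j k φ := by
            obtain ⟨l, hj, hk⟩ := exists_ge_ge (n j) (n k)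
            dsimp
            rw [Category.comp_id, key t j l hj, key t k l hk, ← Functor.map_comp_assoc]
            rfl } }
  have hq (t : Cocone F) (j : J) : (q t).ι.app j = a j ≫ τ t j := rfl
  have fac (t : Cocone F) (j : J) : b j ≫ hc.desc (q t) = τ t j := by
    have e : homOfLE (le_refl (n j)) = 𝟙 (n j) := rfl
    rw [← hrb, Category.assoc, hc.fac, hq, ← hτ t j (n j) (Or.inr le_rfl),
      interleavedMap_of_ne G a r (hn' j).ne le_rfl, e, G.map_id, Category.id_comp,
      Category.assoc]
  have hc' : IsColimit c' :=
    { desc t := hc.desc (q t)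
      fac := fac
      uniq t m hm := by
        apply hc.hom_ext
        intro j
        have h : b j ≫ m = τ t j := hm j
        rw [hc.fac, hq, ← hab, Category.assoc, h] }
  exact ⟨{ I := Sparse n, dir := hJ.sparse hn, F := F, mem := hs, c := c', hc := hc',
           iso := Iso.refl _ }⟩

lemma kappaDirected_toType_ord (hκ : κ.IsRegular) : KappaDirected κ κ.ord.ToType := by
  intro s hs
  have : ¬ IsCofinal s := by
    intro h
    have := Order.cof_le h
    rw [Ordinal.cof_toType, hκ.cof_ord] at this
    exact this.not_gt hs
  rw [not_isCofinal_iff] at this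
  obtain ⟨j, hj⟩ := this
  exact ⟨j, fun i hi => (hj i hi).le⟩

lemma KappaDirected.exists_noMaxOrder (hκ : κ.IsRegular) {J : Type v} [PartialOrder J]
    (hJ : KappaDirected κ J) :
    ∃ (J' : Type v) (_ : PartialOrder J') (_ : NoMaxOrder J') (f : J' → J),
      KappaDirected κ J' ∧ Monotone f ∧ Function.Surjective f := by
  have hW := kappaDirected_toType_ord hκ
  have := Cardinal.noMaxOrder hκ.aleph0_le
  obtain ⟨w₀⟩ := hW.nonempty hκ
  refine ⟨J × κ.ord.ToType, inferInstance, inferInstance, Prod.fst, fun s hs => ?_, monotone_fst,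
    fun j => ⟨(j, w₀), rfl⟩⟩
  obtain ⟨j, hj⟩ := hJ (Prod.fst '' s) (Cardinal.mk_image_le.trans_lt hs)
  obtain ⟨w, hw⟩ := hW (Prod.snd '' s) (Cardinal.mk_image_le.trans_lt hs)
  exact ⟨(j, w), fun x hx => ⟨hj _ ⟨x, hx, rfl⟩, hw _ ⟨x, hx, rfl⟩⟩⟩

lemma mem_kappaLimClosure_of_factor (hκ : κ.IsRegular) {S : Set K}
    (hS : ∀ X ∈ S, KappaPresentableObj κ X) {J : Type v} [PartialOrder J]
    (hJ : KappaDirected κ J) {G : J ⥤ K} (hG : ∀ j, KappaPresentableObj κ (G.obj j))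
    {c : Cocone G} (hc : IsColimit c)
    (H : ∀ j, ∃ s ∈ S, ∃ (a : G.obj j ⟶ s) (b : s ⟶ c.pt), a ≫ b = c.ι.app j) :
    c.pt ∈ kappaLimClosure κ S := by
  obtain ⟨J', _, _, f, hJ', hf, hf'⟩ := hJ.exists_noMaxOrder hκ
  have := hJ.isDirectedOrder hκ
  have := hJ'.isDirectedOrder hκ
  have : hf.functor.Final := by
    rw [Monotone.final_functor_iff]
    intro j
    obtain ⟨j', rfl⟩ := hf' j
    exact ⟨j', le_rfl⟩
  exact mem_kappaLimClosure_of_factor_of_noMaxOrder hκ hS hJ' (G := hf.functor ⋙ G)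
    (fun j => hG (f j)) ((Functor.Final.isColimitWhiskerEquiv hf.functor c).symm hc)
    (fun j => H (f j))

end Lazard

section Extensions

variable {κ : Cardinal.{v}} {S : Set K}

lemma exists_isColimit_of_mem_kappaLimClosure {M : K} (hM : M ∈ kappaLimClosure κ S) :
    ∃ (I : Type v) (_ : PartialOrder I) (F : I ⥤ K) (c : Cocone F) (_ : IsColimit c),
      KappaDirected κ I ∧ (∀ i, F.obj i ∈ S) ∧ c.pt = M := by
  obtain ⟨⟨I, dir, F, mem, c, hc, iso⟩⟩ := hM
  exact ⟨I, _, F, c.extend iso.hom, hc.extendIso iso.hom, dir, mem, rfl⟩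

variable [Abelian K] [HasExt.{w} K]

lemma exists_isPushout_of_extPreservesKappaDirectLimits {I : Type v} [PartialOrder I]
    (hI : KappaDirected κ I) {F : I ⥤ K} {c : Cocone F} (hc : IsColimit c) {B P : K}
    (hB : ExtPreservesKappaDirectLimits κ 1 B) {i : c.pt ⟶ P} {q : P ⟶ B} (w : i ≫ q = 0)
    (hP : (ShortComplex.mk i q w).ShortExact) :
    ∃ (Y : ShortComplex K) (_ : Y.ShortExact) (_ : Y.X₃ = B) (k : I) (y : Y.X₁ ⟶ F.obj k)
      (t : Y.X₂ ⟶ P), IsPushout Y.f (y ≫ c.ι.app k) t i := by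
  obtain ⟨k, e, he⟩ := (hB I hI F c hc).1 hP.extClass
  obtain ⟨Q, p, _, hp⟩ := exists_epi_mk₀_comp_eq_zero e
  have hY : (ShortComplex.mk (kernel.ι p) p (kernel.condition p)).ShortExact :=
    { exact := ShortComplex.exact_of_f_is_kernel _ (kernelIsKernel p) }
  obtain ⟨y₀, hy₀⟩ := Abelian.Ext.contravariant_sequence_exact₃ hY _ e hp (add_zero 1)
  obtain ⟨y, rfl⟩ := (Abelian.Ext.mk₀_bijective _ _).2 y₀
  obtain ⟨t, ht, htq⟩ := exists_hom_of_extClass_comp_eq hY w hP (y ≫ c.ι.app k) (by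
    rw [← he, ← hy₀, Abelian.Ext.comp_assoc _ _ _ (add_zero 1) (add_zero 0) rfl,
      Abelian.Ext.mk₀_comp_mk₀])
  exact ⟨_, hY, rfl, k, y, t, isPushout_of_shortExact hY w hP _ t ht htq⟩

lemma exists_factor_of_shortExact (hκ : κ.IsRegular)
    (hS : ∀ X ∈ S, ExtPreservesKappaDirectLimits κ 1 X) (hext : ClosedUnderExtensions S)
    {I J : Type v} [PartialOrder I] [PartialOrder J] (hI : KappaDirected κ I)
    (hJ : KappaDirected κ J) {F : I ⥤ K} {G : J ⥤ K} {c : Cocone F} {d : Cocone G}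
    (hc : IsColimit c) (hd : IsColimit d) (hF : ∀ i, F.obj i ∈ S) (hG : ∀ j, G.obj j ∈ S)
    {E : K} {f : c.pt ⟶ E} {g : E ⟶ d.pt} {w : f ≫ g = 0}
    (hE : (ShortComplex.mk f g w).ShortExact) {T : K} (hT : KappaPresentableObj κ T)
    (x : T ⟶ E) :
    ∃ s ∈ S, ∃ (a : T ⟶ s) (b : s ⟶ E), a ≫ b = x := by
  obtain ⟨j, z, hz⟩ := (hT J hJ G d hd).1 (x ≫ g)
  have sq := IsPullback.of_hasPullback g (d.ι.app j)
  let ι : c.pt ⟶ pullback g (d.ι.app j) := sq.lift f 0 (by rw [w, zero_comp])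
  have hι : ι ≫ pullback.snd g (d.ι.app j) = 0 := sq.lift_snd _ _ _
  have hP := shortExact_of_isPullback hE sq (sq.lift_fst _ _ _) hι
  obtain ⟨Y, hY, hY₃, k, y, t, sq'⟩ :=
    exists_isPushout_of_extPreservesKappaDirectLimits hI hc (hS _ (hG j)) hι hP
  obtain ⟨l, h, a, b, hab⟩ := exists_factor_pushout hκ hT hI hc sq' (sq.lift x z hz.symm)
  have sq'' := IsPushout.of_hasPushout Y.f (y ≫ F.map (homOfLE h))
  refine ⟨_, hext _ (shortExact_of_isPushout hY sq'' (sq''.inl_desc Y.g 0 (by simp))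
    (sq''.inr_desc _ _ _)) (hF l) (hY₃ ▸ hG j), a, b ≫ pullback.fst _ _, ?_⟩
  rw [reassoc_of% hab, sq.lift_fst]

end Extensions

theorem statement18 [Abelian K] [HasExt.{w} K]
    (κ : Cardinal.{v}) (hκ : κ.IsRegular)
    (hloc : LocallyKappaPresentable κ K)
    (S : Set K)
    (hS : ∀ X ∈ S, KappaPresentableObj κ X ∧ ExtPreservesKappaDirectLimits κ 1 X)
    (hext : ClosedUnderExtensions S) :
    ClosedUnderExtensions (kappaLimClosure κ S) := by
  rintro @⟨A, E, B, f, g, w⟩ hX hA hB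
  obtain ⟨-, ι, T, hT, hgen⟩ := hloc
  obtain ⟨I, _, F, c, hc, hI, hF, rfl⟩ := exists_isColimit_of_mem_kappaLimClosure hA
  obtain ⟨J, _, G, d, hd, hJ, hG, rfl⟩ := exists_isColimit_of_mem_kappaLimClosure hB
  obtain ⟨L, _, H, e, he, hL, hH, rfl⟩ := exists_isColimit_of_mem_kappaLimClosure (hgen E)
  have hH' (l : L) : KappaPresentableObj κ (H.obj l) := by
    obtain ⟨x, hx⟩ := hH l
    exact hx ▸ hT x
  exact mem_kappaLimClosure_of_factor hκ (fun X hX => (hS X hX).1) hL hH' he fun l =>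
    exists_factor_of_shortExact hκ (fun X hX => (hS X hX).2) hext hI hJ hc hd hF hG hX (hH' l) _

end GenPeriodicity
end
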